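/- (Prime ends under removal of a totally disconnected set, plane case.) Let U ⊆ ℝ² be an open simply connected set such that ℝ²∖U has more than one point, and let S₀ ⊆ ℝ² be an open connected set with U ⊊ S₀ such that ℝ²∖S₀ is totally disconnected. Then the inclusion i : U → c_E(U,S₀) extends to a homeomorphism i_* : c_E(U,ℝ²) → c_E(U,S₀) with i_*(u) = u for all u ∈ U. -/

import Mathlib

open Set Topology Filter

noncomputable section

universe u

variable {X : Type u} [TopologicalSpace X]

/-- A homeomorphism is *orientation preserving* if it is isotopic to the identity. -/
def IsOrientationPreserving (f : X ≃ₜ X) : Prop :=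
  ∃ H : unitInterval × X → X,
    Continuous H ∧ (∀ x, H (0, x) = x) ∧ (∀ x, H (1, x) = f x) ∧
      ∀ t : unitInterval, IsHomeomorph fun x => H (t, x)

/-- `D` is a connected component of `A`. -/
def IsCompOf (A D : Set X) : Prop := ∃ x ∈ A, D = connectedComponentIn A x

/-- `A` has exactly two connected components, the distinct sets `D₁` and `D₂`. -/
def HasTwoComps (A D₁ D₂ : Set X) : Prop :=
  IsCompOf A D₁ ∧ IsCompOf A D₂ ∧ D₁ ≠ D₂ ∧
    ∀ x ∈ A, connectedComponentIn A x = D₁ ∨ connectedComponentIn A x = D₂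

/-- A *cross-cut* of the open set `U`: the image of an arc `g` on `(0,1)`, where `g` is
continuous and injective on `[0,1]`'s interior, runs inside `U`, has endpoints on `∂U`, and
separates `U` into exactly two components, each with a boundary point on `∂U` away from the
closed arc. -/
def IsCrossCut (U γ : Set X) : Prop :=
  ∃ g : ℝ → X,
    ContinuousOn g (Icc 0 1) ∧ InjOn g (Ioo 0 1) ∧ (∀ t ∈ Ioo (0:ℝ) 1, g t ∈ U) ∧
      g 0 ∈ frontier U ∧ g 1 ∈ frontier U ∧ γ = g '' Ioo 0 1 ∧
      ∃ D₁ D₂ : Set X, HasTwoComps (U \ γ) D₁ D₂ ∧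
        (frontier D₁ ∩ (frontier U \ g '' Icc 0 1)).Nonempty ∧
        (frontier D₂ ∩ (frontier U \ g '' Icc 0 1)).Nonempty

/-- A *cross-section* of `U`: a connected component of `U ∖ γ` for a cross-cut `γ`. -/
def IsCrossSection (U D : Set X) : Prop := ∃ γ : Set X, IsCrossCut U γ ∧ IsCompOf (U \ γ) D

/-- The image of a set under the `k`-th integer iterate of a homeomorphism. -/
def iterZ (f : X ≃ₜ X) (k : ℤ) (A : Set X) : Set X := ⇑(f.toEquiv ^ k) '' A

/-- A cross-section of `U` which is wandering for `f^n`. -/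
def IsWanderingSection (f : X ≃ₜ X) (U : Set X) (n : ℕ) (D : Set X) : Prop :=
  IsCrossSection U D ∧ ∀ k : ℤ, k ≠ 0 → iterZ f ((n : ℤ) * k) D ∩ D = ∅

/-- `f` is ∂-nonwandering in `U`. -/
def BdNonwandering (f : X ≃ₜ X) (U : Set X) : Prop :=
  ∀ n : ℕ, 1 ≤ n → ∃ K : Set X, IsCompact K ∧ K ⊆ U ∧
    ∀ D : Set X, IsWanderingSection f U n D →
      (∃ k : ℤ, 0 < k ∧ (iterZ f ((n : ℤ) * k) D ∩ K).Nonempty) ∧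
      (∃ k : ℤ, k < 0 ∧ (iterZ f ((n : ℤ) * k) D ∩ K).Nonempty)

/-- The boundary of `D` inside `U` (for `D` open in `U`). -/
def bdIn (U D : Set X) : Set X := (closure D \ D) ∩ U

/-- A chain of cross-sections of `U`. -/
def IsPEChain (U : Set X) (D : ℕ → Set X) : Prop :=
  (∀ i, IsCrossSection U (D i)) ∧ (∀ i j : ℕ, j ≤ i → D i ⊆ D j) ∧
    ∀ i j : ℕ, i ≠ j → closure (bdIn U (D i)) ∩ closure (bdIn U (D j)) = ∅

/-- The chain `D` divides the cross-section `E`. -/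
def ChainDividesSection (D : ℕ → Set X) (E : Set X) : Prop := ∃ N : ℕ, ∀ i, N ≤ i → D i ⊆ E

/-- The chain `D` divides the chain `D'`. -/
def ChainDivides (D D' : ℕ → Set X) : Prop := ∀ n : ℕ, ∃ m : ℕ, D m ⊆ D' n

/-- A prime chain: a chain dividing every chain that divides it. -/
def IsPrimeChain (U : Set X) (D : ℕ → Set X) : Prop :=
  IsPEChain U D ∧ ∀ D' : ℕ → Set X, IsPEChain U D' → ChainDivides D' D → ChainDivides D D'

/-- The type of prime chains of `U`. -/
def PrimeChain (U : Set X) : Type u := {D : ℕ → Set X // IsPrimeChain U D}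

/-- A prime end of `U`: an equivalence class of prime chains. -/
def PrimeEnd (U : Set X) : Type u :=
  Quot fun C C' : PrimeChain U => ChainDivides C.1 C'.1 ∧ ChainDivides C'.1 C.1

/-- The prime end `p` divides the cross-section `E`. -/
def PrimeEndDivides {U : Set X} (p : PrimeEnd U) (E : Set X) : Prop :=
  ∃ C : PrimeChain U, Quot.mk _ C = p ∧ ChainDividesSection C.1 E

/-- The prime ends compactification of `U` (as a set: `U ⊔ (prime ends)`). -/
def PrimeEndComp (U : Set X) : Type u := ↥U ⊕ PrimeEnd U

/-- A point of `U`, as an element of the prime ends compactification. -/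
def pePt (U : Set X) (x : ↥U) : PrimeEndComp U := Sum.inl x

/-- A prime end, as an element of the prime ends compactification. -/
def peEnd (U : Set X) (p : PrimeEnd U) : PrimeEndComp U := Sum.inr p

/-- The copy of a subset `V ⊆ U` inside the prime ends compactification. -/
def peOpen (U V : Set X) : Set (PrimeEndComp U) := {z | ∃ x : ↥U, z = pePt U x ∧ (x : X) ∈ V}

/-- The basic set `E ∪ i_E(E)` of the prime ends compactification, for a cross-section `E`. -/
def peSection (U E : Set X) : Set (PrimeEndComp U) :=
  peOpen U E ∪ {z | ∃ p : PrimeEnd U, z = peEnd U p ∧ PrimeEndDivides p E}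

/-- The topology of the prime ends compactification. -/
instance primeEndCompTopology (U : Set X) : TopologicalSpace (PrimeEndComp U) :=
  TopologicalSpace.generateFrom
    ({s | ∃ V : Set X, IsOpen V ∧ V ⊆ U ∧ s = peOpen U V} ∪
      {s | ∃ E : Set X, IsCrossSection U E ∧ s = peSection U E})

/-- The circle of prime ends, as a subset of the prime ends compactification. -/
def PrimeEndCircle (U : Set X) : Set (PrimeEndComp U) := Set.range (peEnd U)

/-- `F` is an extension of `f|_U` to the prime ends compactification of `U`. -/
def IsPEExtension (f : X ≃ₜ X) (U : Set X) (F : PrimeEndComp U ≃ₜ PrimeEndComp U) : Prop :=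
  ∀ (x : X) (hx : x ∈ U) (hfx : f x ∈ U), F (pePt U ⟨x, hx⟩) = pePt U ⟨f x, hfx⟩

/-- An end-cut of `U`: an injective arc in `U` defined on `[0,1)` converging in the ambient
space as `t → 1⁻`. -/
def IsEndCut (U : Set X) (γ : ℝ → X) : Prop :=
  ContinuousOn γ (Ico 0 1) ∧ InjOn γ (Ico 0 1) ∧ (∀ t ∈ Ico (0:ℝ) 1, γ t ∈ U) ∧
    ∃ z : X, Tendsto γ (𝓝[<] (1:ℝ)) (𝓝 z)

/-- `z` is an accessible point of `∂U`. -/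
def IsAccessiblePoint (U : Set X) (z : X) : Prop :=
  ∃ γ : ℝ → X, IsEndCut U γ ∧ Tendsto γ (𝓝[<] (1:ℝ)) (𝓝 z)

/-- `p` is an accessible prime end of `U`. -/
def IsAccessiblePrimeEnd (U : Set X) (p : PrimeEnd U) : Prop :=
  ∃ (γ : ℝ → X) (hγ : ∀ t ∈ Ico (0:ℝ) 1, γ t ∈ U), IsEndCut U γ ∧
    Tendsto (fun t : ↥(Ico (0:ℝ) 1) => pePt U ⟨γ ↑t, hγ ↑t t.2⟩)
      (comap Subtype.val (𝓝[<] (1:ℝ))) (𝓝 (peEnd U p))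

/-- A translation arc for `f` based at `x`: a simple arc from `x` to `f x` meeting its image
only as allowed. -/
def IsTranslationArc (f : X ≃ₜ X) (γ : Set X) (x : X) : Prop :=
  f x ≠ x ∧
    ∃ g : ℝ → X, ContinuousOn g (Icc 0 1) ∧ InjOn g (Icc 0 1) ∧
      g 0 = x ∧ g 1 = f x ∧ γ = g '' Icc 0 1 ∧
      ((⇑f '' γ) ∩ γ = {f x} ∨ ((⇑f '' γ) ∩ γ = {x, f x} ∧ f (f x) = x))

/-- An `N`-translation arc for `f` based at `x` (for `N = 1` this is just a translation arc). -/
def IsNTranslationArc (f : X ≃ₜ X) (N : ℕ) (γ : Set X) (x : X) : Prop :=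
  IsTranslationArc f γ x ∧
    (2 ≤ N →
      (∀ k : ℕ, 2 ≤ k → k ≤ N - 1 → (⇑f)^[k] '' γ ∩ γ = ∅) ∧
        ((⇑f)^[N] '' γ ∩ γ = ∅ ∨ ((⇑f)^[N] '' γ ∩ γ = {x} ∧ (⇑f)^[N + 1] x = x)))

/-- An ∞-translation arc: an `N`-translation arc for every `N ≥ 1`. -/
def IsInfTranslationArc (f : X ≃ₜ X) (γ : Set X) (x : X) : Prop :=
  ∀ N : ℕ, 1 ≤ N → IsNTranslationArc f N γ x

/-- A nonwandering homeomorphism. -/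
def IsNonwanderingMap (f : X → X) : Prop :=
  ∀ V : Set X, IsOpen V → V.Nonempty → ∃ n : ℕ, 1 ≤ n ∧ (f^[n] '' V ∩ V).Nonempty

/-- A loop contained in `A` which is not null-homotopic in `V`. -/
def IsEssentialLoopIn (V A : Set X) : Prop :=
  ∃ (z : ↥V) (δ : Path z z), (∀ t : unitInterval, (↑(δ t) : X) ∈ A) ∧
    ¬ δ.Homotopic (Path.refl z)

/-- An annular continuum: a continuum with an open annular neighborhood `V` such that `V ∖ K`
has exactly two components, each essential in `V`. -/
def IsAnnularContinuum (K : Set X) : Prop :=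
  IsCompact K ∧ IsConnected K ∧ K.Nontrivial ∧
    ∃ V : Set X, IsOpen V ∧ K ⊆ V ∧
      Nonempty (↥V ≃ₜ AddCircle (1 : ℝ) × ↥(Ioo (0 : ℝ) 1)) ∧
      ∃ D₁ D₂ : Set X, HasTwoComps (V \ K) D₁ D₂ ∧
        IsEssentialLoopIn V D₁ ∧ IsEssentialLoopIn V D₂

/-- A set contractible in the ambient surface: it has an open neighborhood homeomorphic to the
plane. -/
def ContractibleInSurface (K : Set X) : Prop :=
  ∃ W : Set X, IsOpen W ∧ K ⊆ W ∧ Nonempty (↥W ≃ₜ (ℝ × ℝ))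

/-- `α ∈ ℝ/ℤ` is rational. -/
def IsRationalAC (α : AddCircle (1 : ℝ)) : Prop := ∃ r : ℚ, α = ((r : ℝ) : AddCircle (1 : ℝ))

/-- The constant `q(α,g)`: the smallest positive integer `q` with `‖qα‖ = 0` if `α` is
rational, and `(2g+1)‖qα‖ < ‖α‖` if `α` is irrational. -/
def qConst (α : AddCircle (1 : ℝ)) (g : ℕ) : ℕ :=
  sInf {q : ℕ | 0 < q ∧
    ((IsRationalAC α ∧ ‖q • α‖ = 0) ∨
      (¬IsRationalAC α ∧ ((2 * g + 1 : ℕ) : ℝ) * ‖q • α‖ < ‖α‖))}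


namespace PlanePrimeEnds

/-- The identification of the plane with `ℂ`. -/
def cx (z : ℝ × ℝ) : ℂ := ⟨z.1, z.2⟩

lemma continuous_cx : Continuous cx := Complex.equivRealProdCLM.symm.continuous

lemma cx_injective : Function.Injective cx := Complex.equivRealProdCLM.symm.injective

lemma cx_sub_ne_zero {z p : ℝ × ℝ} (h : z ≠ p) : cx z - cx p ≠ 0 :=
  sub_ne_zero.2 (cx_injective.ne h)

/-- The quotient `(z - p) / (z - q)`. -/
def quo (p q z : ℝ × ℝ) : ℂ := (cx z - cx p) / (cx z - cx q)

lemma quo_ne_zero {p q z : ℝ × ℝ} (hp : z ≠ p) (hq : z ≠ q) : quo p q z ≠ 0 :=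
  div_ne_zero (cx_sub_ne_zero hp) (cx_sub_ne_zero hq)

lemma continuousOn_quo (p q : ℝ × ℝ) : ContinuousOn (quo p q) {q}ᶜ :=
  ContinuousOn.div (by have := continuous_cx; fun_prop) (by have := continuous_cx; fun_prop)
    fun _ hz => cx_sub_ne_zero hz

/-- The complement of the open ball of radius `R` around the origin. -/
def far (R : ℝ) : Set (ℝ × ℝ) := {z | R ≤ ‖z‖}

lemma isClosed_far (R : ℝ) : IsClosed (far R) := isClosed_le continuous_const continuous_norm

lemma exists_disjoint_far {A : Set (ℝ × ℝ)} (hA : Bornology.IsBounded A) :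
    ∃ R, Disjoint A (far R) := by
  obtain ⟨R, hR⟩ := hA.exists_norm_le
  refine ⟨R + 1, Set.disjoint_left.2 fun z hz hz' => ?_⟩
  have := hR z hz
  have h2 : R + 1 ≤ ‖z‖ := hz'
  linarith

lemma eq_of_exp_eq_one {Y : Type*} [TopologicalSpace Y] {S : Set Y} (hS : IsPreconnected S)
    {ψ : Y → ℂ} (hψ : ContinuousOn ψ S) (h1 : ∀ z ∈ S, Complex.exp (ψ z) = 1)
    {x y : Y} (hx : x ∈ S) (hy : y ∈ S) : ψ x = ψ y := by
  have hpi : (2 * Real.pi * Complex.I : ℂ) ≠ 0 := Complex.two_pi_I_ne_zero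
  have key : ∀ z ∈ S, ∃ n : ℤ, (ψ z / (2 * Real.pi * Complex.I)).re = n ∧
      ψ z = n * (2 * Real.pi * Complex.I) := by
    intro z hz
    obtain ⟨n, hn⟩ := Complex.exp_eq_one_iff.1 (h1 z hz)
    refine ⟨n, ?_, hn⟩
    rw [hn, mul_div_cancel_right₀ _ hpi]
    simp
  have hc : ContinuousOn (fun z => (ψ z / (2 * Real.pi * Complex.I)).re) S :=
    Complex.continuous_re.comp_continuousOn (hψ.div_const _)
  have hpre := hS.image _ hc
  have hsub : ((fun z => (ψ z / (2 * Real.pi * Complex.I)).re) '' S) ⊆ range ((↑) : ℤ → ℝ) := by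
    rintro _ ⟨z, hz, rfl⟩
    obtain ⟨n, hn, -⟩ := key z hz
    exact ⟨n, hn.symm⟩
  have hord := hpre.ordConnected
  have hlt : ∀ n m : ℤ, (n : ℝ) ∈ (fun z => (ψ z / (2 * Real.pi * Complex.I)).re) '' S →
      (m : ℝ) ∈ (fun z => (ψ z / (2 * Real.pi * Complex.I)).re) '' S → m ≤ n := by
    intro n m hn hm
    by_contra! hlt
    have hlt' : (n : ℝ) + 1 ≤ m := by exact_mod_cast hlt
    obtain ⟨k, hk⟩ := hsub (hord.out hn hm (⟨by linarith, by linarith⟩ :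
      (n : ℝ) + 1 / 2 ∈ Icc (n : ℝ) m))
    have h2 : ((2 * k : ℤ) : ℝ) = ((2 * n + 1 : ℤ) : ℝ) := by push_cast; linarith
    have := Int.cast_injective h2
    omega
  obtain ⟨n, hn, hn'⟩ := key x hx
  obtain ⟨m, hm, hm'⟩ := key y hy
  have hn1 := mem_image_of_mem (fun z => (ψ z / (2 * Real.pi * Complex.I)).re) hx
  have hm1 := mem_image_of_mem (fun z => (ψ z / (2 * Real.pi * Complex.I)).re) hy
  simp only [hn, hm] at hn1 hm1
  rw [hn', hm', le_antisymm (hlt m n hm1 hn1) (hlt n m hn1 hm1)]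

lemma log_sub_log_eq {Y : Type*} [TopologicalSpace Y] {S : Set Y} (hS : IsPreconnected S)
    {ℓ m : Y → ℂ} (hℓ : ContinuousOn ℓ S) (hm : ContinuousOn m S)
    (h1 : ∀ z ∈ S, Complex.exp (ℓ z) = Complex.exp (m z))
    {x y : Y} (hx : x ∈ S) (hy : y ∈ S) : ℓ x - m x = ℓ y - m y :=
  eq_of_exp_eq_one hS (hℓ.sub hm)
    (fun z hz => by simp only [Pi.sub_apply, Complex.exp_sub, h1 z hz]; exact div_self (Complex.exp_ne_zero _)) hx hy

lemma exists_log_plane {h : ℝ × ℝ → ℂ} (hc : Continuous h) (h0 : ∀ z, h z ≠ 0) :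
    ∃ L : ℝ × ℝ → ℂ, Continuous L ∧ ∀ z, Complex.exp (L z) = h z := by
  have hcon : ContractibleSpace (univ : Set (ℝ × ℝ)) :=
    convex_univ.contractibleSpace univ_nonempty
  have hsc : IsSimplyConnected (univ : Set (ℝ × ℝ)) := SimplyConnectedSpace.ofContractible _
  obtain ⟨L, hL, hL'⟩ := Complex.exists_continuousOn_eqOn_exp_comp hsc isOpen_univ
    hc.continuousOn (by rintro ⟨z, -, hz⟩; exact h0 z hz)
  exact ⟨L, continuousOn_univ.1 hL, fun z => hL' (mem_univ z)⟩

lemma exponent_eq_zero {h : ℝ × ℝ → ℂ} (hc : Continuous h) (h0 : ∀ z, h z ≠ 0)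
    {p : ℝ × ℝ} {R : ℝ} {n : ℤ} (hn : ∀ z ∈ far R, h z = (cx z - cx p) ^ n) : n = 0 := by
  obtain ⟨L, hL, hL'⟩ := exists_log_plane hc h0
  set r : ℝ := 2 * (|R| + ‖p‖ + 1) with hr
  have hrpos : 0 < r := by positivity
  let c : ℝ → ℝ × ℝ := fun θ => (p.1 + r * Real.cos θ, p.2 + r * Real.sin θ)
  have hcc : Continuous c := by fun_prop
  have hcx : ∀ θ : ℝ, cx (c θ) - cx p = Complex.exp (Real.log r + θ * Complex.I) := by
    intro θ
    rw [Complex.exp_add, ← Complex.ofReal_exp, Real.exp_log hrpos, Complex.exp_mul_I]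
    apply Complex.ext <;> simp [c, cx, ← Complex.ofReal_cos, ← Complex.ofReal_sin]
  have hfar : ∀ θ, c θ ∈ far R := by
    intro θ
    have h1 : |r * Real.cos θ| ≤ ‖c θ‖ + ‖p‖ := by
      have : r * Real.cos θ = (c θ).1 - p.1 := by simp [c]
      rw [this]
      exact (abs_sub _ _).trans (add_le_add (norm_fst_le (c θ)) (norm_fst_le p))
    have h2 : |r * Real.sin θ| ≤ ‖c θ‖ + ‖p‖ := by
      have : r * Real.sin θ = (c θ).2 - p.2 := by simp [c]
      rw [this]
      exact (abs_sub _ _).trans (add_le_add (norm_snd_le (c θ)) (norm_snd_le p))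
    have h3 : |Real.cos θ| ≥ 1 / 2 ∨ |Real.sin θ| ≥ 1 / 2 := by
      by_contra! hcon
      nlinarith [Real.sin_sq_add_cos_sq θ, sq_abs (Real.sin θ), sq_abs (Real.cos θ),
        abs_nonneg (Real.sin θ), abs_nonneg (Real.cos θ)]
    rw [abs_mul, abs_of_pos hrpos] at h1 h2
    have h4 : r / 2 ≤ ‖c θ‖ + ‖p‖ := by
      rcases h3 with h | h <;> nlinarith
    show R ≤ ‖c θ‖
    have := le_abs_self R
    linarith
  have key := log_sub_log_eq (S := (univ : Set ℝ)) isPreconnected_univ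
    (ℓ := fun θ => L (c θ)) (m := fun θ => n * (Real.log r + θ * Complex.I))
    (by fun_prop) (by fun_prop)
    (fun θ _ => by rw [hL', hn _ (hfar θ), hcx, Complex.exp_int_mul])
    (mem_univ 0) (mem_univ (2 * Real.pi))
  have hper : c (2 * Real.pi) = c 0 := by simp [c]
  rw [hper] at key
  have : (n : ℂ) * (2 * Real.pi * Complex.I) = 0 := by
    push_cast at key
    linear_combination key
  simpa [Complex.two_pi_I_ne_zero] using this

lemma exists_continuous_extension {Z : Set (ℝ × ℝ)} (hZ : IsClosed Z) {ℓ : ℝ × ℝ → ℂ}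
    (hℓ : ContinuousOn ℓ Z) : ∃ L : ℝ × ℝ → ℂ, Continuous L ∧ EqOn L ℓ Z := by
  obtain ⟨g, hg⟩ := ContinuousMap.exists_restrict_eq hZ
    ⟨Z.domRestrict ℓ, continuousOn_iff_continuous_domRestrict.1 hℓ⟩
  exact ⟨g, g.continuous, fun z hz => DFunLike.congr_fun hg ⟨z, hz⟩⟩

/-- Gluing a function outside an open set to a logarithmic multiple of another one inside. -/
lemma exists_glue {D Z : Set (ℝ × ℝ)} (hD : IsOpen D) (hZ : IsClosed Z) (hDZ : frontier D ⊆ Z)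
    {F G ℓ : ℝ × ℝ → ℂ} (hF : ContinuousOn F Dᶜ) (hF0 : ∀ z ∈ Dᶜ, F z ≠ 0)
    (hG : ContinuousOn G (closure D)) (hG0 : ∀ z ∈ closure D, G z ≠ 0)
    (hℓ : ContinuousOn ℓ Z) (hFG : ∀ z ∈ Z, F z = Complex.exp (ℓ z) * G z) :
    ∃ h : ℝ × ℝ → ℂ, Continuous h ∧ (∀ z, h z ≠ 0) ∧ EqOn h F (Dᶜ ∪ Z) := by
  classical
  obtain ⟨L, hL, hLℓ⟩ := exists_continuous_extension hZ hℓ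
  refine ⟨fun z => if z ∈ D then Complex.exp (L z) * G z else F z, ?_, ?_, ?_⟩
  · apply continuous_if
    · intro z hz
      have hz : z ∈ frontier D := hz
      rw [hFG z (hDZ hz), hLℓ (hDZ hz)]
    · exact (Complex.continuous_exp.comp hL).continuousOn.mul hG
    · have : {z | z ∉ D} = Dᶜ := rfl
      rw [this, hD.isClosed_compl.closure_eq]
      exact hF
  · intro z
    by_cases hz : z ∈ D
    · simpa [hz] using hG0 z (subset_closure hz)
    · simpa [hz] using hF0 z hz
  · rintro z hz
    by_cases hzD : z ∈ D
    · have hzZ : z ∈ Z := hz.resolve_left (fun h => h hzD)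
      simp [hzD, hFG z hzZ, hLℓ hzZ]
    · simp [hzD]

lemma exponent_eq_zero_of_log {D Z : Set (ℝ × ℝ)} (hD : IsOpen D) (hZ : IsClosed Z)
    (hDZ : frontier D ⊆ Z) {R : ℝ} (hR : far R ⊆ Z) {p₁ p₂ p₃ : ℝ × ℝ} (h₁ : p₁ ∈ D)
    (h₂ : p₂ ∉ closure D) (h₃ : p₃ ∉ closure D) (hp₂ : p₂ ∉ Z) (hp₃ : p₃ ∉ Z) {a b : ℤ}
    {ℓ : ℝ × ℝ → ℂ} (hℓ : ContinuousOn ℓ Z)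
    (h : ∀ z ∈ Z, Complex.exp (ℓ z) = quo p₁ p₃ z ^ a * quo p₂ p₃ z ^ b) : a = 0 := by
  have hcx := continuous_cx
  have hne : ∀ {z p : ℝ × ℝ} {S : Set (ℝ × ℝ)}, z ∈ S → p ∉ S → cx z - cx p ≠ 0 :=
    fun hz hp => cx_sub_ne_zero (by rintro rfl; exact hp hz)
  obtain ⟨f, hf, hf0, hfF⟩ := exists_glue hD hZ hDZ
    (F := fun z => (cx z - cx p₁) ^ a)
    (G := fun z => (cx z - cx p₂) ^ (-b) * (cx z - cx p₃) ^ (a + b)) (ℓ := ℓ)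
    (by
      refine ContinuousOn.zpow₀ (by fun_prop) _ fun z hz => Or.inl ?_
      exact hne hz (by simpa using h₁))
    (fun z hz => zpow_ne_zero _ (hne hz (by simpa using h₁)))
    (by
      refine ContinuousOn.mul ?_ ?_
      · exact ContinuousOn.zpow₀ (by fun_prop) _ fun z hz => Or.inl (hne hz h₂)
      · exact ContinuousOn.zpow₀ (by fun_prop) _ fun z hz => Or.inl (hne hz h₃))
    (fun z hz => mul_ne_zero (zpow_ne_zero _ (hne hz h₂)) (zpow_ne_zero _ (hne hz h₃)))
    hℓ
    (by
      intro z hz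
      have e₂ := hne hz hp₂
      have e₃ := hne hz hp₃
      rw [h z hz, quo, quo, div_zpow, div_zpow, zpow_neg, zpow_add₀ e₃]
      field_simp)
  exact exponent_eq_zero hf hf0 (p := p₁) (R := R) fun z hz => hfF (Or.inr (hR hz))

lemma exists_union {Y : Type*} [TopologicalSpace Y] {A B : Set Y} (hA : IsClosed A) (hB : IsClosed B) {ℓ m : Y → ℂ}
    (hℓ : ContinuousOn ℓ A) (hm : ContinuousOn m B) (h : ∀ z ∈ A, z ∈ B → ℓ z = m z) :
    ∃ k : Y → ℂ, ContinuousOn k (A ∪ B) ∧ EqOn k ℓ A ∧ EqOn k m B := by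
  classical
  have h1 : EqOn (A.piecewise ℓ m) ℓ A := A.piecewise_eqOn ℓ m
  have h2 : EqOn (A.piecewise ℓ m) m B := by
    intro z hz
    by_cases hzA : z ∈ A
    · rw [h1 hzA, h z hzA hz]
    · simp [hzA]
  exact ⟨_, (hℓ.congr h1).union_of_isClosed (hm.congr h2) hA hB, h1, h2⟩

lemma quo_mul_quo {p q r z : ℝ × ℝ} (hq : z ≠ q) : quo p q z * quo q r z = quo p r z :=
  div_mul_div_cancel₀ (cx_sub_ne_zero hq)

lemma quo_inv (p q z : ℝ × ℝ) : (quo p q z)⁻¹ = quo q p z := inv_div _ _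

lemma exists_log_segment (p q : ℝ × ℝ) : ∃ ℓ : ℝ × ℝ → ℂ, ContinuousOn ℓ (segment ℝ p q)ᶜ ∧
    ∀ z ∈ (segment ℝ p q)ᶜ, Complex.exp (ℓ z) = quo p q z := by
  have key : ∀ z ∈ (segment ℝ p q)ᶜ, quo p q z ∈ Complex.slitPlane := by
    intro z hz
    by_contra hcon
    have hzq : z ≠ q := by rintro rfl; exact hz (right_mem_segment ℝ _ _)
    rw [Complex.mem_slitPlane_iff, not_or, not_lt, not_not] at hcon
    obtain ⟨hre, him⟩ := hcon
    set t : ℝ := -(quo p q z).re with ht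
    have hw : quo p q z = ((-t : ℝ) : ℂ) := by
      apply Complex.ext <;> simp [ht, him]
    have ht0 : 0 ≤ t := by linarith
    have h1 : cx z - cx p = ((-t : ℝ) : ℂ) * (cx z - cx q) := by
      rw [← hw, quo, div_mul_cancel₀ _ (cx_sub_ne_zero hzq)]
    have hre := congr_arg Complex.re h1
    have him := congr_arg Complex.im h1
    simp [cx] at hre him
    apply hz
    refine ⟨1 / (1 + t), t / (1 + t), by positivity, by positivity, by field_simp, ?_⟩
    have : (1 + t) ≠ 0 := by positivity
    ext
    · simp; field_simp; linarith
    · simp; field_simp; linarith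
  refine ⟨fun z => Complex.log (quo p q z), ?_, fun z hz => ?_⟩
  · refine ContinuousOn.clog ((continuousOn_quo p q).mono ?_) key
    rintro z hz rfl
    exact hz (right_mem_segment ℝ _ _)
  · exact Complex.exp_log (Complex.slitPlane_ne_zero (key z hz))

lemma isCompact_segment (p q : ℝ × ℝ) : IsCompact (segment ℝ p q) := by
  rw [segment_eq_image_lineMap]
  exact isCompact_Icc.image (AffineMap.lineMap_continuous)

lemma exists_log_compl {D : Set (ℝ × ℝ)} (hD : IsOpen D) (hDc : IsPreconnected D)
    {p q : ℝ × ℝ} (hp : p ∈ D) (hq : q ∈ D) :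
    ∃ C, IsCompact C ∧ C ⊆ D ∧ p ∈ C ∧ q ∈ C ∧ ∃ ℓ : ℝ × ℝ → ℂ, ContinuousOn ℓ Cᶜ ∧
      ∀ z ∈ Cᶜ, Complex.exp (ℓ z) = quo p q z := by
  refine hDc.induction₂ (fun p q => ∃ C, IsCompact C ∧ C ⊆ D ∧ p ∈ C ∧ q ∈ C ∧
    ∃ ℓ : ℝ × ℝ → ℂ, ContinuousOn ℓ Cᶜ ∧ ∀ z ∈ Cᶜ, Complex.exp (ℓ z) = quo p q z)
    ?_ ?_ ?_ hp hq
  · intro x hx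
    obtain ⟨r, hr, hball⟩ := Metric.isOpen_iff.1 hD x hx
    filter_upwards [mem_nhdsWithin_of_mem_nhds (Metric.ball_mem_nhds x hr)] with y hy
    obtain ⟨ℓ, h1, h2⟩ := exists_log_segment x y
    exact ⟨segment ℝ x y, isCompact_segment x y,
      ((convex_ball x r).segment_subset (Metric.mem_ball_self hr) hy).trans hball,
      left_mem_segment _ _ _, right_mem_segment _ _ _, ℓ, h1, h2⟩
  · rintro x y z - - - ⟨C, hC, hCD, hx, hy, ℓ, h1, h2⟩ ⟨C', hC', hCD', hy', hz, ℓ', h1', h2'⟩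
    refine ⟨C ∪ C', hC.union hC', union_subset hCD hCD', Or.inl hx, Or.inr hz, ℓ + ℓ', ?_, ?_⟩
    · exact (h1.mono (compl_subset_compl.2 subset_union_left)).add
        (h1'.mono (compl_subset_compl.2 subset_union_right))
    · intro w hw
      have hw1 : w ∈ Cᶜ := fun h => hw (Or.inl h)
      have hw2 : w ∈ C'ᶜ := fun h => hw (Or.inr h)
      rw [Pi.add_apply, Complex.exp_add, h2 w hw1, h2' w hw2, quo_mul_quo]
      rintro rfl
      exact hw1 hy
  · rintro x y - - ⟨C, hC, hCD, hx, hy, ℓ, h1, h2⟩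
    refine ⟨C, hC, hCD, hy, hx, -ℓ, h1.neg, fun z hz => ?_⟩
    rw [Pi.neg_apply, Complex.exp_neg, h2 z hz, quo_inv]

lemma exists_log_arc {h : ℝ → ℝ × ℝ} {s t : ℝ} (hst : s ≤ t) (hc : ContinuousOn h (Icc s t))
    (hi : InjOn h (Icc s t)) {f : ℝ × ℝ → ℂ} (hf : ContinuousOn f (h '' Icc s t))
    (hf0 : ∀ z ∈ h '' Icc s t, f z ≠ 0) :
    ∃ ℓ : ℝ × ℝ → ℂ, ContinuousOn ℓ (h '' Icc s t) ∧
      ∀ z ∈ h '' Icc s t, Complex.exp (ℓ z) = f z := by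
  have hcon : ContractibleSpace (univ : Set ℝ) := convex_univ.contractibleSpace univ_nonempty
  have hsc : IsSimplyConnected (univ : Set ℝ) := SimplyConnectedSpace.ofContractible _
  have hF : Continuous fun x : ℝ => f (h (projIcc s t hst x)) := by
    have h1 : ContinuousOn (f ∘ h) (Icc s t) := hf.comp hc (mapsTo_image _ _)
    exact (continuousOn_iff_continuous_domRestrict.1 h1).comp continuous_projIcc
  obtain ⟨L, hL, hL'⟩ := Complex.exists_continuousOn_eqOn_exp_comp hsc isOpen_univ
    hF.continuousOn (by rintro ⟨z, -, hz⟩; exact hf0 _ (mem_image_of_mem h (projIcc s t hst z).2) hz)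
  have he : IsClosedEmbedding (fun x : Icc s t => h x) :=
    (continuousOn_iff_continuous_domRestrict.1 hc).isClosedEmbedding
      fun x y hxy => Subtype.ext (hi x.2 y.2 hxy)
  obtain ⟨g, hg⟩ := ContinuousMap.exists_extension' he
    ⟨fun x : Icc s t => L x, (continuousOn_univ.1 hL).comp continuous_subtype_val⟩
  refine ⟨g, g.continuous.continuousOn, ?_⟩
  rintro _ ⟨x, hx, rfl⟩
  have h1 : g (h x) = L x := congr_fun hg ⟨x, hx⟩
  have h2 := hL' (mem_univ x)
  simp only [Function.comp_apply, projIcc_of_mem hst hx] at h2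
  rw [h1, h2]

lemma exists_log_totallyDisconnected {P : Set (ℝ × ℝ)} (hP : IsCompact P)
    (hPd : IsTotallyDisconnected P) {f : ℝ × ℝ → ℂ} (hf : ContinuousOn f P)
    (hf0 : ∀ z ∈ P, f z ≠ 0) :
    ∃ ℓ : ℝ × ℝ → ℂ, ContinuousOn ℓ P ∧ ∀ z ∈ P, Complex.exp (ℓ z) = f z := by
  classical
  have : CompactSpace P := isCompact_iff_compactSpace.1 hP
  have : TotallyDisconnectedSpace P := totallyDisconnectedSpace_subtype_iff.2 hPd
  have hF : Continuous fun x : P => f x := continuousOn_iff_continuous_domRestrict.1 hf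
  have key : ∃ V : Set P, IsClopen V ∧ univ ⊆ V ∧ ∃ ℓ : P → ℂ, ContinuousOn ℓ V ∧
      ∀ z ∈ V, Complex.exp (ℓ z) = f z := by
    refine isCompact_univ.induction_on (p := fun s => ∃ V : Set P, IsClopen V ∧ s ⊆ V ∧
      ∃ ℓ : P → ℂ, ContinuousOn ℓ V ∧ ∀ z ∈ V, Complex.exp (ℓ z) = f z) ?_ ?_ ?_ ?_
    · exact ⟨∅, isClopen_empty, subset_rfl, 0, by simp, by simp⟩
    · rintro s t hst ⟨V, hV, htV, h⟩
      exact ⟨V, hV, hst.trans htV, h⟩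
    · rintro s t ⟨V, hV, hs, ℓ, h1, h2⟩ ⟨V', hV', ht, ℓ', h1', h2'⟩
      have hVV : IsClopen (V' \ V) := hV'.diff hV
      obtain ⟨k, hk, hk1, hk2⟩ := exists_union hV.1 hVV.1 h1 (h1'.mono sdiff_subset)
        (fun z hz hz' => absurd hz hz'.2)
      have huV : V ∪ V' \ V = V ∪ V' := union_sdiff_self
      rw [huV] at hk
      refine ⟨V ∪ V', hV.union hV', union_subset_union hs ht, k, hk, fun z hz => ?_⟩
      by_cases hzV : z ∈ V
      · rw [hk1 hzV, h2 z hzV]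
      · have hz' := hz.resolve_left hzV
        rw [hk2 ⟨hz', hzV⟩, h2' z hz']
    · intro x _
      have hx0 : f x ≠ 0 := hf0 _ x.2
      have hO : IsOpen {y : P | f y / f x ∈ Complex.slitPlane} :=
        Complex.isOpen_slitPlane.preimage (hF.div_const _)
      obtain ⟨V, hV, hxV, hVO⟩ := compact_exists_isClopen_in_isOpen hO
        (by show f x / f x ∈ Complex.slitPlane; rw [div_self hx0]; exact Complex.one_mem_slitPlane)
      refine ⟨V, mem_nhdsWithin_of_mem_nhds (hV.2.mem_nhds hxV), V, hV, subset_rfl,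
        fun y => Complex.log (f y / f x) + Complex.log (f x), ?_, fun y hy => ?_⟩
      · exact ((hF.div_const _).continuousOn.clog fun y hy => hVO hy).add continuousOn_const
      · rw [Complex.exp_add, Complex.exp_log (Complex.slitPlane_ne_zero (hVO hy)),
          Complex.exp_log hx0, div_mul_cancel₀ _ hx0]
  obtain ⟨V, -, huV, ℓ, h1, h2⟩ := key
  have h1 : Continuous ℓ := continuousOn_univ.1 (h1.mono huV)
  obtain ⟨g, hg⟩ := ContinuousMap.exists_restrict_eq hP.isClosed ⟨ℓ, h1⟩
  refine ⟨g, g.continuous.continuousOn, fun z hz => ?_⟩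
  have h3 : g z = ℓ ⟨z, hz⟩ := DFunLike.congr_fun hg ⟨z, hz⟩
  rw [h3, h2 _ (huV (mem_univ _))]

/-- A closed set whose part in a ball is totally disconnected is locally compactly separated. -/
lemma exists_open_isCompact_inter {Y : Set (ℝ × ℝ)} (hY : IsClosed Y) {z : ℝ × ℝ} (hz : z ∈ Y)
    {r : ℝ} (hr : 0 < r) {T : Set (ℝ × ℝ)} (hT : IsTotallyDisconnected T)
    (hYT : Y ∩ Metric.ball z r ⊆ T) :
    ∃ O, IsOpen O ∧ z ∈ O ∧ O ⊆ Metric.ball z r ∧ IsCompact (Y ∩ O) := by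
  set P := Y ∩ Metric.closedBall z (r / 2) with hPdef
  have hP : IsCompact P := (isCompact_closedBall z (r / 2)).inter_left hY
  have hPT : P ⊆ T := fun w hw => hYT ⟨hw.1, Metric.closedBall_subset_ball (by linarith) hw.2⟩
  have : CompactSpace P := isCompact_iff_compactSpace.1 hP
  have : TotallyDisconnectedSpace P := totallyDisconnectedSpace_subtype_iff.2 fun t ht => hT t (ht.trans hPT)
  obtain ⟨V, hV, hzV, hVO⟩ := compact_exists_isClopen_in_isOpen
    (Metric.isOpen_ball.preimage continuous_subtype_val : IsOpen
      ((Subtype.val : P → ℝ × ℝ) ⁻¹' Metric.ball z (r / 2)))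
    (x := ⟨z, hz, Metric.mem_closedBall_self (by linarith)⟩)
    (Metric.mem_ball_self (by linarith))
  obtain ⟨W, hW, hWV⟩ := isOpen_induced_iff.1 hV.2
  have hWP : Y ∩ (W ∩ Metric.ball z (r / 2)) = Subtype.val '' V := by
    ext w
    constructor
    · rintro ⟨h1, h2, h3⟩
      exact ⟨⟨w, h1, Metric.ball_subset_closedBall h3⟩, by rw [← hWV]; exact h2, rfl⟩
    · rintro ⟨⟨w, hw⟩, hwV, rfl⟩
      have h3 := hVO hwV
      rw [← hWV] at hwV
      exact ⟨hw.1, hwV, h3⟩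
  refine ⟨W ∩ Metric.ball z (r / 2), hW.inter Metric.isOpen_ball, ?_, ?_, ?_⟩
  · refine ⟨?_, Metric.mem_ball_self (by linarith)⟩
    rw [← hWV] at hzV
    exact hzV
  · exact inter_subset_right.trans (Metric.ball_subset_ball (by linarith))
  · rw [hWP]
    exact hV.1.isCompact.image continuous_subtype_val

lemma isPreconnected_far {R : ℝ} (hR : 0 < R) : IsPreconnected (far R) := by
  have h0 : IsPreconnected ({0}ᶜ : Set (ℝ × ℝ)) :=
    (isConnected_compl_singleton_of_one_lt_rank (by simp [one_add_one_eq_two]) _).isPreconnected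
  have hc : ContinuousOn (fun z : ℝ × ℝ => max 1 (R / ‖z‖) • z) {0}ᶜ := by
    have h1 : ContinuousOn (fun z : ℝ × ℝ => R / ‖z‖) {0}ᶜ :=
      continuousOn_const.div continuous_norm.continuousOn fun z hz => norm_ne_zero_iff.2 hz
    fun_prop
  convert h0.image _ hc using 1
  ext w
  constructor
  · intro hw
    have hw' : R ≤ ‖w‖ := hw
    have hpos : 0 < ‖w‖ := hR.trans_le hw'
    refine ⟨w, norm_pos_iff.1 hpos, ?_⟩
    have : max 1 (R / ‖w‖) = 1 := max_eq_left ((div_le_one hpos).2 hw')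
    simp [this]
  · rintro ⟨z, hz, rfl⟩
    have hpos : 0 < ‖z‖ := norm_pos_iff.2 hz
    show R ≤ ‖max 1 (R / ‖z‖) • z‖
    rw [norm_smul, Real.norm_eq_abs, abs_of_pos (by positivity)]
    calc R = R / ‖z‖ * ‖z‖ := by field_simp
      _ ≤ _ := by gcongr; exact le_max_right _ _

lemma inter_frontier_nonempty {Y : Type*} [TopologicalSpace Y] {B V : Set Y}
    (hB : IsPreconnected B) (h1 : (B ∩ V).Nonempty) (h2 : (B ∩ Vᶜ).Nonempty) :
    (B ∩ frontier V).Nonempty := by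
  by_contra hcon
  rw [not_nonempty_iff_eq_empty] at hcon
  have hmem : ∀ z ∈ B, z ∉ frontier V := fun z hz hz' => by
    have : z ∈ B ∩ frontier V := ⟨hz, hz'⟩
    simp [hcon] at this
  obtain ⟨z, -, hz, hz'⟩ := hB (interior V) (closure V)ᶜ isOpen_interior isClosed_closure.isOpen_compl
    (fun z hz => by
      by_cases hzc : z ∈ closure V
      · exact Or.inl (by_contra fun hi => hmem z hz ⟨hzc, hi⟩)
      · exact Or.inr hzc)
    (by
      obtain ⟨z, hz, hzV⟩ := h1
      exact ⟨z, hz, by_contra fun hi => hmem z hz ⟨subset_closure hzV, hi⟩⟩)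
    (by
      obtain ⟨z, hz, hzV⟩ := h2
      refine ⟨z, hz, fun hc => hmem z hz ⟨hc, fun hi => hzV (interior_subset hi)⟩⟩)
  exact hz' (interior_subset_closure hz)

lemma frontier_connectedComponentIn_subset {A : Set (ℝ × ℝ)} (hA : IsOpen A) (x : ℝ × ℝ) :
    frontier (connectedComponentIn A x) ⊆ Aᶜ := by
  intro y hy hyA
  have hD := hA.connectedComponentIn (x := x)
  rw [hD.frontier_eq] at hy
  have hD' := hA.connectedComponentIn (x := y)
  obtain ⟨w, hw, hw'⟩ := mem_closure_iff.1 hy.1 _ hD' (mem_connectedComponentIn hyA)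
  apply hy.2
  rw [connectedComponentIn_eq hw', ← connectedComponentIn_eq hw]
  exact mem_connectedComponentIn hyA

lemma notMem_closure_connectedComponentIn {A : Set (ℝ × ℝ)} (hA : IsOpen A) {x y : ℝ × ℝ}
    (hy : y ∈ A) (hyx : y ∉ connectedComponentIn A x) :
    y ∉ closure (connectedComponentIn A x) := by
  intro hc
  have hD := hA.connectedComponentIn (x := x)
  apply frontier_connectedComponentIn_subset hA x _ hy
  rw [hD.frontier_eq]
  exact ⟨hc, hyx⟩

lemma mem_connectedComponentIn_of_log {Z : Set (ℝ × ℝ)} (hZ : IsClosed Z) {R : ℝ}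
    {p q : ℝ × ℝ} (hp : p ∉ Z) (hq : q ∉ Z) (hqR : q ∉ far R) {ℓ : ℝ × ℝ → ℂ}
    (hℓ : ContinuousOn ℓ (Z ∪ far R)) (h : ∀ z ∈ Z ∪ far R, Complex.exp (ℓ z) = quo p q z) :
    q ∈ connectedComponentIn Zᶜ p := by
  by_contra hcon
  have hD := hZ.isOpen_compl.connectedComponentIn (x := p)
  have hqc := notMem_closure_connectedComponentIn hZ.isOpen_compl hq hcon
  have hfr := frontier_connectedComponentIn_subset hZ.isOpen_compl p
  rw [compl_compl] at hfr
  have hqZ : q ∉ Z ∪ far R := fun hh => hh.elim hq hqR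
  have := exponent_eq_zero_of_log hD (hZ.union (isClosed_far R)) (hfr.trans subset_union_left)
    subset_union_right (mem_connectedComponentIn hp) hqc hqc hqZ hqZ (a := 1) (b := 0) hℓ
    (fun z hz => by simp [h z hz])
  simp at this

section SimplyConnected

variable {U : Set (ℝ × ℝ)}

lemma compl_inter_eq_empty (hU : IsOpen U) (hsc : SimplyConnectedSpace U) {O : Set (ℝ × ℝ)}
    (hO : IsOpen O) (hP : IsCompact (Uᶜ ∩ O)) : Uᶜ ∩ O = ∅ := by
  by_contra hne
  obtain ⟨c, hcU, hcO⟩ := nonempty_iff_ne_empty.2 hne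
  obtain ⟨N, hN, hPN, hNO, hNc⟩ := exists_open_between_and_isCompact_closure hP hO inter_subset_right
  have hfr : frontier N ⊆ U := by
    intro z hz
    by_contra hzU
    have hz1 : z ∈ N := hPN ⟨hzU, hNO (frontier_subset_closure hz)⟩
    rw [hN.frontier_eq] at hz
    exact hz.2 hz1
  have hcx := continuous_cx
  obtain ⟨L, hL, hL'⟩ := Complex.exists_continuousOn_eqOn_exp_comp hsc hU
    (g := fun z => cx z - cx c) (by fun_prop)
    (by
      rintro ⟨z, hz, hz0⟩
      exact cx_sub_ne_zero (by rintro rfl; exact hcU hz) hz0)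
  obtain ⟨R, hR⟩ := exists_disjoint_far hNc.isBounded
  obtain ⟨f, hf, hf0, hfF⟩ := exists_glue hN isClosed_frontier (subset_refl (frontier N))
    (F := fun z => cx z - cx c) (G := fun _ => 1) (ℓ := L) (by fun_prop)
    (fun z hz => cx_sub_ne_zero (by rintro rfl; exact hz (hPN ⟨hcU, hcO⟩)))
    continuousOn_const (fun _ _ => one_ne_zero) (hL.mono hfr)
    (fun z hz => by simpa using (hL' (hfr hz)).symm)
  have := exponent_eq_zero hf hf0 (p := c) (R := R) (n := 1) fun z hz => by
    rw [zpow_one, hfF (Or.inl fun hzN => hR.le_bot ⟨subset_closure hzN, hz⟩)]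
  simp at this

lemma exists_const_of_exp_eq_one (hU : IsOpen U) (hsc : SimplyConnectedSpace U)
    {C : Set (ℝ × ℝ)} (hC : IsCompact C) (hCU : C ⊆ U) {ψ : ℝ × ℝ → ℂ} (hψ : ContinuousOn ψ Cᶜ)
    (h : ∀ z ∈ Cᶜ, Complex.exp (ψ z) = 1) : ∃ R v, Disjoint C (far R) ∧
      ∀ z ∈ Uᶜ ∪ far R, ψ z = v := by
  obtain ⟨R₀, hR₀⟩ := exists_disjoint_far hC.isBounded
  set R := max R₀ 1
  have hR : Disjoint C (far R) := hR₀.mono_right fun z (hz : R ≤ ‖z‖) =>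
    show R₀ ≤ ‖z‖ from (le_max_left _ _).trans hz
  have hRpos : 0 < R := lt_max_of_lt_right one_pos
  set w : ℝ × ℝ := (R, 0)
  have hw : w ∈ far R := by
    show R ≤ ‖w‖
    exact (le_abs_self R).trans (norm_fst_le w)
  have hfar : ∀ z ∈ far R, ψ z = ψ w := fun z hz =>
    eq_of_exp_eq_one (isPreconnected_far hRpos)
      (hψ.mono fun y hy hyC => hR.le_bot ⟨hyC, hy⟩)
      (fun y hy => h y fun hyC => hR.le_bot ⟨hyC, hy⟩) hz hw
  refine ⟨R, ψ w, hR, fun z hz => hz.elim (fun hzU => ?_) (hfar z)⟩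
  by_contra hne
  have hCo : IsOpen Cᶜ := hC.isClosed.isOpen_compl
  set O := {y | y ∈ Cᶜ ∧ ψ y ≠ ψ w} with hOdef
  have hO : IsOpen O := hψ.isOpen_inter_preimage hCo isOpen_ne
  have hOc : ∀ y ∈ Cᶜ, ∀ᶠ y' in 𝓝 y, ψ y' = ψ y := by
    intro y hy
    obtain ⟨r, hr, hball⟩ := Metric.isOpen_iff.1 hCo y hy
    filter_upwards [Metric.ball_mem_nhds y hr] with y' hy'
    exact eq_of_exp_eq_one (convex_ball y r).isPreconnected (hψ.mono hball)
      (fun x hx => h x (hball hx)) hy' (Metric.mem_ball_self hr)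
  have hclosed : IsClosed (Uᶜ ∩ O) := by
    rw [← isOpen_compl_iff, isOpen_iff_mem_nhds]
    intro y hy
    by_cases hyC : y ∈ C
    · filter_upwards [hU.mem_nhds (hCU hyC)] with x hx hx'
      exact hx'.1 hx
    by_cases hyU : y ∈ U
    · filter_upwards [hU.mem_nhds hyU] with x hx hx'
      exact hx'.1 hx
    have hy1 : ψ y = ψ w := by
      by_contra hy2
      exact hy ⟨hyU, hyC, hy2⟩
    filter_upwards [hOc y hyC] with x hx hx'
    exact hx'.2.2 (hx.trans hy1)
  have hcomp : IsCompact (Uᶜ ∩ O) := by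
    refine Metric.isCompact_of_isClosed_isBounded hclosed
      ((Metric.isBounded_ball (x := 0) (r := R)).subset ?_)
    intro y hy
    rw [mem_ball_zero_iff]
    by_contra! hyR
    exact hy.2.2 (hfar y hyR)
  have := compl_inter_eq_empty hU hsc hO hcomp
  have hz : z ∈ Uᶜ ∩ O := ⟨hzU, fun hzC => hzU (hCU hzC), hne⟩
  rw [this] at hz
  exact hz

lemma ball_sdiff_subset {T V : Set (ℝ × ℝ)} (hT : IsTotallyDisconnected T) (hV : IsOpen V)
    {z : ℝ × ℝ} {r : ℝ} (hVB : (Metric.ball z r ∩ V).Nonempty)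
    (hfr : frontier V ∩ Metric.ball z r ⊆ T) : Metric.ball z r \ T ⊆ V := by
  rintro x ⟨hxB, hxT⟩
  by_contra hxV
  have hBp : IsPreconnected (Metric.ball z r) := (convex_ball z r).isPreconnected
  have hxc : x ∉ closure V := fun hxc => hxT (hfr ⟨by rw [hV.frontier_eq]; exact ⟨hxc, hxV⟩, hxB⟩)
  obtain ⟨z₀, hz₀B, hz₀⟩ := inter_frontier_nonempty (V := closure V) hBp
    (hVB.mono (inter_subset_inter_right _ subset_closure)) ⟨x, hxB, hxc⟩
  have hz₀V := frontier_closure_subset hz₀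
  obtain ⟨r₀, hr₀, hball₀⟩ := Metric.isOpen_iff.1 Metric.isOpen_ball z₀ hz₀B
  obtain ⟨O, hO, hz₀O, hOB, hOc⟩ := exists_open_isCompact_inter isClosed_frontier hz₀V hr₀ hT
    (fun y hy => hfr ⟨hy.1, hball₀ hy.2⟩)
  obtain ⟨δ, hδ, hδO⟩ := Metric.isOpen_iff.1 hO z₀ hz₀O
  obtain ⟨p, hpB, hpV⟩ := mem_closure_iff.1 (frontier_subset_closure hz₀V) _ Metric.isOpen_ball
    (Metric.mem_ball_self hδ)
  rw [← frontier_compl] at hz₀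
  obtain ⟨q, hqB, hqV⟩ := mem_closure_iff.1 (frontier_subset_closure hz₀) _ Metric.isOpen_ball
    (Metric.mem_ball_self hδ)
  have hseg : segment ℝ p q ⊆ O := ((convex_ball z₀ δ).segment_subset hpB hqB).trans hδO
  have hpF : p ∉ frontier V := fun h => by rw [hV.frontier_eq] at h; exact h.2 hpV
  have hqF : q ∉ frontier V := fun h => hqV (frontier_subset_closure h)
  have hPT : IsTotallyDisconnected (frontier V ∩ O) := fun t ht => hT t
    (ht.trans fun y hy => hfr ⟨hy.1, hball₀ (hOB hy.2)⟩)
  have hq0 : frontier V ⊆ {q}ᶜ := by rintro y hy rfl; exact hqF hy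
  obtain ⟨ℓ, hℓ, hℓ'⟩ := exists_log_totallyDisconnected hOc hPT (f := quo p q)
    ((continuousOn_quo p q).mono (inter_subset_left.trans hq0))
    (fun y hy => quo_ne_zero (by rintro rfl; exact hpF hy.1) (hq0 hy.1))
  obtain ⟨m, hm, hm'⟩ := exists_log_segment p q
  obtain ⟨R, hR⟩ := exists_disjoint_far
    ((hOc.union (isCompact_segment p q)).isBounded)
  have hsub : (frontier V ∩ Oᶜ) ∪ far R ⊆ (segment ℝ p q)ᶜ := by
    rintro y (hy | hy) hys
    · exact hy.2 (hseg hys)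
    · exact hR.le_bot ⟨Or.inr hys, hy⟩
  have hcl2 : IsClosed ((frontier V ∩ Oᶜ) ∪ far R) :=
    (isClosed_frontier.inter hO.isClosed_compl).union (isClosed_far R)
  obtain ⟨k, hk, hk1, hk2⟩ := exists_union hOc.isClosed hcl2 hℓ (hm.mono hsub) (by
    rintro y hy (hy' | hy')
    · exact absurd hy.2 hy'.2
    · exact absurd ⟨Or.inl hy, hy'⟩ (fun h => hR.le_bot h))
  have hqZ : q ∉ (frontier V ∩ O) ∪ ((frontier V ∩ Oᶜ) ∪ far R) := by
    rintro (h | h)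
    · exact hqF h.1
    · exact hsub h (right_mem_segment _ _ _)
  have := exponent_eq_zero_of_log hV (hOc.isClosed.union hcl2)
    (by
      intro y hy
      by_cases hyO : y ∈ O
      · exact Or.inl ⟨hy, hyO⟩
      · exact Or.inr (Or.inl ⟨hy, hyO⟩))
    (R := R) (subset_union_right.trans subset_union_right) hpV hqV hqV hqZ hqZ (a := 1) (b := 0) hk
    (by
      rintro y (hy | hy)
      · simp [hk1 hy, hℓ' y hy]
      · simp [hk2 hy, hm' y (hsub hy)])
  simp at this

lemma exists_mem_frontier_notMem (hU : IsOpen U) (hsc : SimplyConnectedSpace U)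
    {V T : Set (ℝ × ℝ)} (hV : IsOpen V) (hVU : V ⊆ U) (hT : IsTotallyDisconnected T)
    {z : ℝ × ℝ} (hz : z ∉ U) {r : ℝ} (hVB : (Metric.ball z r ∩ V).Nonempty) :
    ∃ w ∈ frontier V, w ∈ Metric.ball z r ∧ w ∉ T := by
  by_contra! hcon
  have hr : 0 < r := Metric.nonempty_ball.1 (hVB.mono inter_subset_left)
  have hBV := ball_sdiff_subset hT hV hVB fun w hw => hcon w hw.1 hw.2
  obtain ⟨O, hO, hzO, -, hOc⟩ := exists_open_isCompact_inter hU.isClosed_compl hz hr hT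
    (fun w hw => by_contra fun hwT => hw.1 (hVU (hBV ⟨hw.2, hwT⟩)))
  have hz' : z ∈ Uᶜ ∩ O := ⟨hz, hzO⟩
  rw [compl_inter_eq_empty hU hsc hO hOc] at hz'
  exact hz'

end SimplyConnected

lemma isTotallyDisconnected_insert {T : Set (ℝ × ℝ)} (hT : IsTotallyDisconnected T)
    (hTc : IsClosed T) (a : ℝ × ℝ) : IsTotallyDisconnected (insert a T) := by
  intro t ht htp
  by_cases ha : a ∈ T
  · exact hT t (by rwa [insert_eq_of_mem ha] at ht) htp
  · have h1 : t ⊆ {a} ∪ T := by rwa [insert_eq] at ht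
    rcases isPreconnected_iff_subset_of_disjoint_closed.1 htp {a} T isClosed_singleton hTc h1
      (by
        ext y
        simp only [mem_inter_iff, mem_singleton_iff, mem_empty_iff_false, iff_false]
        rintro ⟨-, rfl, h⟩
        exact ha h) with h | h
    · exact subsingleton_singleton.anti h
    · exact hT t h htp

lemma exists_log_arc_of_eq {h : ℝ → ℝ × ℝ} {s t : ℝ} (hst : s ≤ t) (hc : ContinuousOn h (Icc s t))
    (hi : InjOn h (Icc s t)) {f : ℝ × ℝ → ℂ} (hf : ContinuousOn f (h '' Icc s t))
    (hf0 : ∀ z ∈ h '' Icc s t, f z ≠ 0) {u : ℝ} (hu : u ∈ Icc s t) {v : ℂ}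
    (hv : Complex.exp v = f (h u)) :
    ∃ ℓ : ℝ × ℝ → ℂ, ContinuousOn ℓ (h '' Icc s t) ∧ ℓ (h u) = v ∧
      ∀ z ∈ h '' Icc s t, Complex.exp (ℓ z) = f z := by
  obtain ⟨ℓ, h1, h2⟩ := exists_log_arc hst hc hi hf hf0
  refine ⟨fun z => ℓ z + (v - ℓ (h u)), h1.add continuousOn_const, by ring, fun z hz => ?_⟩
  have := hf0 _ (mem_image_of_mem h hu)
  rw [Complex.exp_add, Complex.exp_sub, hv, h2 _ hz, h2 _ (mem_image_of_mem h hu),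
    div_self this, mul_one]

/-- A parametrized arc or loop running in `U`, with ends on the frontier of `U`. -/
structure IsCut (U : Set (ℝ × ℝ)) (g : ℝ → ℝ × ℝ) : Prop where
  cont : ContinuousOn g (Icc 0 1)
  inj : InjOn g (Ioo 0 1)
  mem : ∀ t ∈ Ioo (0 : ℝ) 1, g t ∈ U
  left : g 0 ∈ frontier U
  right : g 1 ∈ frontier U

lemma isPreconnected_of_simplyConnectedSpace {U : Set (ℝ × ℝ)} (hsc : SimplyConnectedSpace U) : IsPreconnected U :=
  isPreconnected_iff_preconnectedSpace.2 inferInstance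

lemma notMem_of_mem_frontier {Y : Type*} [TopologicalSpace Y] {U : Set Y} (hU : IsOpen U) {z : Y}
    (hz : z ∈ frontier U) : z ∉ U := by
  rw [hU.frontier_eq] at hz
  exact hz.2

namespace IsCut

variable {U : Set (ℝ × ℝ)} {g : ℝ → ℝ × ℝ}

lemma symm (h : IsCut U g) : IsCut U (fun t => g (1 - t)) where
  cont := h.cont.comp (by fun_prop) fun t ht => ⟨by linarith [ht.2], by linarith [ht.1]⟩
  inj := fun s hs t ht hst => by
    have := h.inj ⟨by linarith [hs.2], by linarith [hs.1]⟩ ⟨by linarith [ht.2], by linarith [ht.1]⟩ hst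
    linarith
  mem := fun t ht => h.mem _ ⟨by linarith [ht.2], by linarith [ht.1]⟩
  left := by simpa using h.right
  right := by simpa using h.left

lemma image_symm_Icc (g : ℝ → ℝ × ℝ) : (fun t => g (1 - t)) '' Icc 0 1 = g '' Icc 0 1 := by
  have := image_image g (fun t : ℝ => 1 - t) (Icc 0 1)
  rw [← this, image_const_sub_Icc]
  norm_num

lemma image_symm_Ioo (g : ℝ → ℝ × ℝ) : (fun t => g (1 - t)) '' Ioo 0 1 = g '' Ioo 0 1 := by
  have := image_image g (fun t : ℝ => 1 - t) (Ioo 0 1)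
  rw [← this, image_const_sub_Ioo]
  norm_num

lemma isCompact (h : IsCut U g) : IsCompact (g '' Icc 0 1) := isCompact_Icc.image_of_continuousOn h.cont

lemma mem_Ioo (h : IsCut U g) (hU : IsOpen U) {t : ℝ} (ht : t ∈ Icc (0 : ℝ) 1) (hg : g t ∈ U) :
    t ∈ Ioo (0 : ℝ) 1 := by
  refine ⟨ht.1.lt_of_ne ?_, ht.2.lt_of_ne ?_⟩
  · rintro rfl; exact notMem_of_mem_frontier hU h.left hg
  · rintro rfl; exact notMem_of_mem_frontier hU h.right hg

lemma sdiff_eq (h : IsCut U g) (hU : IsOpen U) : U \ g '' Ioo 0 1 = (Uᶜ ∪ g '' Icc 0 1)ᶜ := by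
  ext z
  simp only [Set.mem_sdiff, compl_union, compl_compl, mem_inter_iff, mem_compl_iff, and_congr_right_iff]
  refine fun hz => not_congr ⟨fun hh => image_mono Ioo_subset_Icc_self hh, ?_⟩
  rintro ⟨t, ht, rfl⟩
  exact ⟨t, h.mem_Ioo hU ht hz, rfl⟩

lemma isClosed (h : IsCut U g) (hU : IsOpen U) : IsClosed (Uᶜ ∪ g '' Icc 0 1) :=
  hU.isClosed_compl.union h.isCompact.isClosed

lemma isOpen_sdiff (h : IsCut U g) (hU : IsOpen U) : IsOpen (U \ g '' Ioo 0 1) := by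
  rw [h.sdiff_eq hU]
  exact (h.isClosed hU).isOpen_compl

lemma injOn_Ico (h : IsCut U g) (hU : IsOpen U) : InjOn g (Ico 0 1) := by
  intro s hs t ht hst
  rcases hs.1.eq_or_lt with rfl | hs0 <;> rcases ht.1.eq_or_lt with rfl | ht0
  · rfl
  · exact absurd (hst ▸ h.mem t ⟨ht0, ht.2⟩) (notMem_of_mem_frontier hU h.left)
  · exact absurd (hst ▸ h.mem s ⟨hs0, hs.2⟩) (notMem_of_mem_frontier hU h.left)
  · exact h.inj ⟨hs0, hs.2⟩ ⟨ht0, ht.2⟩ hst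

lemma injOn_Ioc (h : IsCut U g) (hU : IsOpen U) : InjOn g (Ioc 0 1) := by
  intro s hs t ht hst
  have := h.symm.injOn_Ico hU (x₁ := 1 - s) (x₂ := 1 - t) ⟨by linarith [hs.2], by linarith [hs.1]⟩
    ⟨by linarith [ht.2], by linarith [ht.1]⟩ (by simpa using hst)
  linarith

lemma mem_compl_sdiff (h : IsCut U g) (hU : IsOpen U) {p : ℝ × ℝ} (hp : p ∈ U \ g '' Ioo 0 1) :
    p ∉ Uᶜ ∪ g '' Icc 0 1 := by
  rw [h.sdiff_eq hU] at hp
  exact hp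

/-- The complement of an injective cut has at most two components. -/
lemma mem_connectedComponentIn_of_three (h : IsCut U g) (hU : IsOpen U)
    (hsc : SimplyConnectedSpace U) (hi : InjOn g (Icc 0 1)) {p₁ p₂ p₃ : ℝ × ℝ}
    (h₁ : p₁ ∈ U \ g '' Ioo 0 1) (h₂ : p₂ ∈ U \ g '' Ioo 0 1) (h₃ : p₃ ∈ U \ g '' Ioo 0 1) :
    p₂ ∈ connectedComponentIn (U \ g '' Ioo 0 1) p₁ ∨
    p₃ ∈ connectedComponentIn (U \ g '' Ioo 0 1) p₁ ∨
    p₃ ∈ connectedComponentIn (U \ g '' Ioo 0 1) p₂ := by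
  by_contra! hcon
  obtain ⟨c₁₂, c₁₃, c₂₃⟩ := hcon
  have hUc := isPreconnected_of_simplyConnectedSpace hsc
  obtain ⟨C₁, hC₁, hC₁U, hp₁, hp₃, ℓ₁, hℓ₁, hℓ₁'⟩ := exists_log_compl hU hUc h₁.1 h₃.1
  obtain ⟨C₂, hC₂, hC₂U, hp₂, hp₃', ℓ₂, hℓ₂, hℓ₂'⟩ := exists_log_compl hU hUc h₂.1 h₃.1
  obtain ⟨R, hR⟩ := exists_disjoint_far ((hC₁.union hC₂).union h.isCompact).isBounded
  have n₁ := h.mem_compl_sdiff hU h₁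
  have n₂ := h.mem_compl_sdiff hU h₂
  have n₃ := h.mem_compl_sdiff hU h₃
  have hγ : ∀ p, p ∉ Uᶜ ∪ g '' Icc 0 1 → ∀ z ∈ g '' Icc 0 1, z ≠ p := by
    rintro p hp z hz rfl
    exact hp (Or.inr hz)
  have m0 : (0 : ℝ) ∈ Icc (0 : ℝ) 1 := ⟨le_rfl, zero_le_one⟩
  have m1 : (1 : ℝ) ∈ Icc (0 : ℝ) 1 := ⟨zero_le_one, le_rfl⟩
  have g0U : g 0 ∈ Uᶜ := notMem_of_mem_frontier hU h.left
  have g1U : g 1 ∈ Uᶜ := notMem_of_mem_frontier hU h.right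
  have s₁ : Uᶜ ⊆ C₁ᶜ := compl_subset_compl.2 hC₁U
  have s₂ : Uᶜ ⊆ C₂ᶜ := compl_subset_compl.2 hC₂U
  have f₁ : far R ⊆ C₁ᶜ := fun z hz hz' => hR.le_bot ⟨Or.inl (Or.inl hz'), hz⟩
  have f₂ : far R ⊆ C₂ᶜ := fun z hz hz' => hR.le_bot ⟨Or.inl (Or.inr hz'), hz⟩
  have hcont : ∀ p, ContinuousOn (quo p p₃) (g '' Icc 0 1) := fun p =>
    (continuousOn_quo p p₃).mono fun z hz => hγ _ n₃ z hz
  obtain ⟨k₁, hk₁, e₁, hk₁'⟩ := exists_log_arc_of_eq zero_le_one h.cont hi (hcont p₁)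
    (fun z hz => quo_ne_zero (hγ _ n₁ z hz) (hγ _ n₃ z hz)) m0 (hℓ₁' _ (s₁ g0U))
  obtain ⟨k₂, hk₂, e₂, hk₂'⟩ := exists_log_arc_of_eq zero_le_one h.cont hi (hcont p₂)
    (fun z hz => quo_ne_zero (hγ _ n₂ z hz) (hγ _ n₃ z hz)) m0 (hℓ₂' _ (s₂ g0U))
  obtain ⟨a, ha⟩ := Complex.exp_eq_exp_iff_exists_int.1
    ((hk₁' _ (mem_image_of_mem g m1)).trans (hℓ₁' _ (s₁ g1U)).symm)
  obtain ⟨b, hb⟩ := Complex.exp_eq_exp_iff_exists_int.1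
    ((hk₂' _ (mem_image_of_mem g m1)).trans (hℓ₂' _ (s₂ g1U)).symm)
  have hcl : IsClosed (Uᶜ ∪ far R) := hU.isClosed_compl.union (isClosed_far R)
  have hint : ∀ z ∈ Uᶜ ∪ far R, z ∈ g '' Icc 0 1 → z = g 0 ∨ z = g 1 := by
    rintro z (hz | hz) ⟨t, ht, rfl⟩
    · by_cases t0 : t = 0
      · simp [t0]
      by_cases t1 : t = 1
      · simp [t1]
      exact absurd (h.mem t ⟨ht.1.lt_of_ne' t0, ht.2.lt_of_ne t1⟩) hz
    · exact absurd ⟨Or.inr ⟨t, ht, rfl⟩, hz⟩ (fun hh => hR.le_bot hh)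
  have hUR₁ : Uᶜ ∪ far R ⊆ C₁ᶜ := union_subset s₁ f₁
  have hUR₂ : Uᶜ ∪ far R ⊆ C₂ᶜ := union_subset s₂ f₂
  have hZ : IsClosed ((Uᶜ ∪ far R) ∪ g '' Icc 0 1) := hcl.union h.isCompact.isClosed
  have far₂ : p₂ ∉ far R := fun hh => f₂ hh hp₂
  have far₃ : p₃ ∉ far R := fun hh => f₁ hh hp₃
  by_cases hb0 : b = 0
  · obtain ⟨k, hk, hkl, hkr⟩ := exists_union hcl h.isCompact.isClosed (hℓ₂.mono hUR₂) hk₂ (by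
      rintro z hz hz'
      rcases hint z hz hz' with rfl | rfl
      · exact e₂.symm
      · rw [hb, hb0]; simp)
    rw [union_right_comm] at hk
    apply c₂₃
    rw [h.sdiff_eq hU]
    refine mem_connectedComponentIn_of_log (h.isClosed hU) n₂ n₃ far₃ hk ?_
    rw [union_right_comm]
    rintro z (hz | hz)
    · rw [hkl hz, hℓ₂' z (hUR₂ hz)]
    · rw [hkr hz, hk₂' z hz]
  · obtain ⟨k, hk, hkl, hkr⟩ := exists_union hcl h.isCompact.isClosed
      (ℓ := fun z => b * ℓ₁ z - a * ℓ₂ z) (m := fun z => b * k₁ z - a * k₂ z)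
      (((hℓ₁.mono hUR₁).const_mul _).sub ((hℓ₂.mono hUR₂).const_mul _))
      ((hk₁.const_mul _).sub (hk₂.const_mul _)) (by
      rintro z hz hz'
      rcases hint z hz hz' with rfl | rfl
      · simp only [e₁, e₂]
      · simp only [ha, hb]; ring)
    have hexp : ∀ x y : ℂ, Complex.exp (b * x - a * y) = Complex.exp x ^ b * Complex.exp y ^ (-a) := by
      intro x y
      rw [Complex.exp_sub, Complex.exp_int_mul, Complex.exp_int_mul, zpow_neg, div_eq_mul_inv]
    have hop := h.isOpen_sdiff hU
    have hnZ : ∀ p, p ∉ Uᶜ ∪ g '' Icc 0 1 → p ∉ far R → p ∉ (Uᶜ ∪ far R) ∪ g '' Icc 0 1 := by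
      intro p hp hp'
      rw [union_right_comm]
      exact fun hh => hh.elim hp hp'
    apply hb0
    refine exponent_eq_zero_of_log (hop.connectedComponentIn (x := p₁)) hZ ?_
      (subset_union_right.trans subset_union_left) (mem_connectedComponentIn h₁)
      (notMem_closure_connectedComponentIn hop h₂ c₁₂)
      (notMem_closure_connectedComponentIn hop h₃ c₁₃)
      (hnZ _ n₂ far₂) (hnZ _ n₃ far₃) (b := -a) hk ?_
    · refine (frontier_connectedComponentIn_subset hop p₁).trans ?_
      rw [h.sdiff_eq hU, compl_compl, union_right_comm]
      exact subset_union_left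
    · rintro z (hz | hz)
      · rw [hkl hz, hexp, hℓ₁' z (hUR₁ hz), hℓ₂' z (hUR₂ hz)]
      · rw [hkr hz, hexp, hk₁' z hz, hk₂' z hz]

/-- Every component of the complement of a cut accumulates on the whole cut. -/
lemma image_subset_closure (h : IsCut U g) (hU : IsOpen U) (hsc : SimplyConnectedSpace U)
    {p : ℝ × ℝ} (hp : p ∈ U \ g '' Ioo 0 1) :
    g '' Ioo 0 1 ⊆ closure (connectedComponentIn (U \ g '' Ioo 0 1) p) := by
  rintro _ ⟨u, hu, rfl⟩
  by_contra hucl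
  set D := connectedComponentIn (U \ g '' Ioo 0 1) p with hDdef
  have hop := h.isOpen_sdiff hU
  have hD : IsOpen D := hop.connectedComponentIn
  have hcu : ContinuousAt g u := h.cont.continuousAt (Icc_mem_nhds hu.1 hu.2)
  obtain ⟨δ, hδ, hball⟩ := Metric.mem_nhds_iff.1
    (Filter.inter_mem (hcu (isClosed_closure.isOpen_compl.mem_nhds hucl)) (Ioo_mem_nhds hu.1 hu.2))
  have hnear : ∀ t, |t - u| < δ → g t ∉ closure D ∧ t ∈ Ioo (0 : ℝ) 1 := fun t ht => by
    have := hball (show t ∈ Metric.ball u δ by rwa [Metric.mem_ball, Real.dist_eq])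
    exact this
  set s := u - δ / 2 with hs
  set t := u + δ / 2 with ht
  have hs0 : s ∈ Ioo (0 : ℝ) 1 := (hnear s (by rw [hs, abs_lt]; constructor <;> linarith)).2
  have ht0 : t ∈ Ioo (0 : ℝ) 1 := (hnear t (by rw [ht, abs_lt]; constructor <;> linarith)).2
  have hUc := isPreconnected_of_simplyConnectedSpace hsc
  obtain ⟨C, hC, hCU, hpC, hcC, ℓ, hℓ, hℓ'⟩ := exists_log_compl hU hUc hp.1 (h.mem u hu)
  obtain ⟨R, hR⟩ := exists_disjoint_far (hC.union h.isCompact).isBounded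
  have np := h.mem_compl_sdiff hU hp
  have hUR : Uᶜ ∪ far R ⊆ Cᶜ := union_subset (compl_subset_compl.2 hCU)
    fun z hz hz' => hR.le_bot ⟨Or.inl hz', hz⟩
  have hsubA : Icc 0 s ⊆ Ico (0 : ℝ) 1 := fun x hx => ⟨hx.1, hx.2.trans_lt hs0.2⟩
  have hsubB : Icc t 1 ⊆ Ioc (0 : ℝ) 1 := fun x hx => ⟨ht0.1.trans_le hx.1, hx.2⟩
  have hA1 : Icc 0 s ⊆ Icc (0 : ℝ) 1 := hsubA.trans Ico_subset_Icc_self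
  have hB1 : Icc t 1 ⊆ Icc (0 : ℝ) 1 := hsubB.trans Ioc_subset_Icc_self
  have hAc : ∀ z ∈ g '' Icc 0 s, z ≠ g u := by
    rintro _ ⟨x, hx, rfl⟩ hxu
    have := h.injOn_Ico hU (hsubA hx) ⟨hu.1.le, hu.2⟩ hxu
    linarith [hx.2]
  have hBc : ∀ z ∈ g '' Icc t 1, z ≠ g u := by
    rintro _ ⟨x, hx, rfl⟩ hxu
    have := h.injOn_Ioc hU (hsubB hx) ⟨hu.1, hu.2.le⟩ hxu
    linarith [hx.1]
  have hγp : ∀ z ∈ g '' Icc 0 1, z ≠ p := by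
    rintro z hz rfl
    exact np (Or.inr hz)
  have g0U : g 0 ∈ Uᶜ := notMem_of_mem_frontier hU h.left
  have g1U : g 1 ∈ Uᶜ := notMem_of_mem_frontier hU h.right
  obtain ⟨k₁, hk₁, e₁, hk₁'⟩ := exists_log_arc_of_eq hs0.1.le (h.cont.mono hA1)
    ((h.injOn_Ico hU).mono hsubA) ((continuousOn_quo p (g u)).mono hAc)
    (fun z hz => quo_ne_zero (hγp z (image_mono hA1 hz)) (hAc z hz)) ⟨le_rfl, hs0.1.le⟩
    (hℓ' _ (hUR (Or.inl g0U)))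
  obtain ⟨k₂, hk₂, e₂, hk₂'⟩ := exists_log_arc_of_eq ht0.2.le (h.cont.mono hB1)
    ((h.injOn_Ioc hU).mono hsubB) ((continuousOn_quo p (g u)).mono hBc)
    (fun z hz => quo_ne_zero (hγp z (image_mono hB1 hz)) (hBc z hz)) ⟨ht0.2.le, le_rfl⟩
    (hℓ' _ (hUR (Or.inl g1U)))
  have hcl : IsClosed (Uᶜ ∪ far R) := hU.isClosed_compl.union (isClosed_far R)
  have hAcl : IsClosed (g '' Icc 0 s) := (isCompact_Icc.image_of_continuousOn (h.cont.mono hA1)).isClosed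
  have hBcl : IsClosed (g '' Icc t 1) := (isCompact_Icc.image_of_continuousOn (h.cont.mono hB1)).isClosed
  have hfarg : ∀ x ∈ Icc (0 : ℝ) 1, g x ∉ far R := fun x hx hx' => hR.le_bot ⟨Or.inr ⟨x, hx, rfl⟩, hx'⟩
  obtain ⟨k, hk, hkl, hkr⟩ := exists_union hcl hAcl (hℓ.mono hUR) hk₁ (by
    rintro z hz ⟨x, hx, rfl⟩
    have hx0 : x = 0 := by
      by_contra hx0
      exact hz.elim (fun hz => hz (h.mem x ⟨hx.1.lt_of_ne' hx0, (hsubA hx).2⟩)) (hfarg x (hA1 hx))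
    rw [hx0, e₁])
  obtain ⟨m, hm, hml, hmr⟩ := exists_union (hcl.union hAcl) hBcl hk hk₂ (by
    rintro z hz ⟨x, hx, rfl⟩
    have hx1 : g x = g 1 := by
      by_contra hx1
      have hxI : x ∈ Ioo (0 : ℝ) 1 := ⟨(hsubB hx).1, hx.2.lt_of_ne (by rintro rfl; exact hx1 rfl)⟩
      rcases hz with hz | ⟨y, hy, hyx⟩
      · exact hz.elim (fun hz => hz (h.mem x hxI)) (hfarg x (hB1 hx))
      · have := h.injOn_Ico hU (hsubA hy) ⟨hxI.1.le, hxI.2⟩ hyx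
        linarith [hy.2, hx.1]
    rw [hx1, hkl (Or.inl g1U), e₂])
  have huZ : g u ∉ ((Uᶜ ∪ far R) ∪ g '' Icc 0 s) ∪ g '' Icc t 1 := by
    rintro ((hz | hz) | hz)
    · exact hz.elim (fun hz => hz (h.mem u hu)) (hfarg u (Ioo_subset_Icc_self hu))
    · exact hAc _ hz rfl
    · exact hBc _ hz rfl
  have := exponent_eq_zero_of_log hD ((hcl.union hAcl).union hBcl) (R := R) (p₁ := p)
    (by
      intro z hz
      have hz' := frontier_connectedComponentIn_subset hop p hz
      rw [h.sdiff_eq hU, compl_compl] at hz'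
      rcases hz' with hz' | ⟨x, hx, rfl⟩
      · exact Or.inl (Or.inl (Or.inl hz'))
      · by_cases hxs : x ≤ s
        · exact Or.inl (Or.inr ⟨x, ⟨hx.1, hxs⟩, rfl⟩)
        by_cases hxt : t ≤ x
        · exact Or.inr ⟨x, ⟨hxt, hx.2⟩, rfl⟩
        push Not at hxs hxt
        exact absurd (frontier_subset_closure hz)
          (hnear x (by rw [abs_lt]; constructor <;> linarith)).1)
    ((subset_union_right.trans subset_union_left).trans subset_union_left)
    (mem_connectedComponentIn hp) hucl hucl huZ huZ (a := 1) (b := 0) hm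
    (by
      rintro z ((hz | hz) | hz)
      · rw [hml (Or.inl hz), hkl hz, hℓ' z (hUR hz)]; simp
      · rw [hml (Or.inr hz), hkr hz, hk₁' z hz]; simp
      · rw [hmr hz, hk₂' z hz]; simp)
  simp at this

lemma bdIn_eq (h : IsCut U g) (hU : IsOpen U) (hsc : SimplyConnectedSpace U) {D : Set (ℝ × ℝ)}
    (hD : IsCompOf (U \ g '' Ioo 0 1) D) : bdIn U D = g '' Ioo 0 1 := by
  obtain ⟨p, hp, rfl⟩ := hD
  have hop := h.isOpen_sdiff hU
  apply Subset.antisymm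
  · rintro z ⟨hz, hzU⟩
    rw [← (hop.connectedComponentIn).frontier_eq] at hz
    have := frontier_connectedComponentIn_subset hop p hz
    by_contra hzg
    exact this ⟨hzU, hzg⟩
  · rintro z hz
    refine ⟨⟨h.image_subset_closure hU hsc hp hz, fun hzD => ?_⟩, ?_⟩
    · exact (connectedComponentIn_subset _ _ hzD).2 hz
    · obtain ⟨t, ht, rfl⟩ := hz
      exact h.mem t ht

lemma closure_image (h : IsCut U g) : closure (g '' Ioo 0 1) = g '' Icc 0 1 := by
  apply Subset.antisymm
  · exact closure_minimal (image_mono Ioo_subset_Icc_self) h.isCompact.isClosed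
  · rw [← closure_Ioo zero_ne_one]
    exact ContinuousOn.image_closure (by rw [closure_Ioo zero_ne_one]; exact h.cont)

end IsCut

/-- `A` is an arc from `p` to `q`. -/
def IsArc (A : Set (ℝ × ℝ)) (p q : ℝ × ℝ) : Prop :=
  ∃ h : ℝ → ℝ × ℝ, ContinuousOn h (Icc 0 1) ∧ InjOn h (Icc 0 1) ∧ h 0 = p ∧ h 1 = q ∧
    A = h '' Icc 0 1

lemma isArc_image {h : ℝ → ℝ × ℝ} {s t : ℝ} (hst : s < t) (hc : ContinuousOn h (Icc s t))
    (hi : InjOn h (Icc s t)) : IsArc (h '' Icc s t) (h s) (h t) := by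
  have hpos : 0 < t - s := sub_pos.2 hst
  have him : (fun x : ℝ => (t - s) * x + s) '' Icc 0 1 = Icc s t := by
    rw [image_affine_Icc' hpos]
    simp
  have hmaps : MapsTo (fun x : ℝ => (t - s) * x + s) (Icc 0 1) (Icc s t) := mapsTo_iff_image_subset.2 him.subset
  refine ⟨fun x => h ((t - s) * x + s), hc.comp (by fun_prop) hmaps, ?_, by simp, by simp, ?_⟩
  · intro x hx y hy hxy
    have := hi (hmaps hx) (hmaps hy) hxy
    simpa [hpos.ne'] using this
  · rw [← him, image_image]

namespace IsArc

variable {A B : Set (ℝ × ℝ)} {p q r : ℝ × ℝ}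

lemma left_mem (hA : IsArc A p q) : p ∈ A := by
  obtain ⟨h, -, -, rfl, -, rfl⟩ := hA
  exact mem_image_of_mem h ⟨le_rfl, zero_le_one⟩

lemma right_mem (hA : IsArc A p q) : q ∈ A := by
  obtain ⟨h, -, -, -, rfl, rfl⟩ := hA
  exact mem_image_of_mem h ⟨zero_le_one, le_rfl⟩

lemma isPreconnected (hA : IsArc A p q) : IsPreconnected A := by
  obtain ⟨h, hc, -, -, -, rfl⟩ := hA
  exact isPreconnected_Icc.image h hc

lemma isCompact (hA : IsArc A p q) : IsCompact A := by
  obtain ⟨h, hc, -, -, -, rfl⟩ := hA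
  exact isCompact_Icc.image_of_continuousOn hc

lemma union (hA : IsArc A p q) (hB : IsArc B q r) (hAB : A ∩ B ⊆ {q}) : IsArc (A ∪ B) p r := by
  obtain ⟨h, hc, hi, rfl, hq, rfl⟩ := hA
  obtain ⟨k, kc, ki, kq, rfl, rfl⟩ := hB
  have m0 : (0 : ℝ) ∈ Icc (0 : ℝ) 1 := ⟨le_rfl, zero_le_one⟩
  have m1 : (1 : ℝ) ∈ Icc (0 : ℝ) 1 := ⟨zero_le_one, le_rfl⟩
  obtain ⟨f, hf, hf1, hf2⟩ := exists_union (isClosed_Icc (a := (0 : ℝ)) (b := 1))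
    (isClosed_Icc (a := (1 : ℝ)) (b := 2)) (ℓ := fun x => cx (h x)) (m := fun x => cx (k (x - 1)))
    (continuous_cx.comp_continuousOn hc)
    (continuous_cx.comp_continuousOn (kc.comp (by fun_prop)
      fun x hx => ⟨by linarith [hx.1], by linarith [hx.2]⟩))
    (fun x hx hx' => by
      obtain rfl : x = 1 := le_antisymm hx.2 hx'.1
      simp [hq, kq])
  set e : ℂ → ℝ × ℝ := fun w => (w.re, w.im)
  have he : Continuous e := by fun_prop
  have hecx : ∀ z, e (cx z) = z := fun z => rfl
  have hu : Icc (0 : ℝ) 1 ∪ Icc 1 2 = Icc 0 2 := Icc_union_Icc_eq_Icc (by norm_num) (by norm_num)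
  rw [hu] at hf
  have g1 : ∀ x ∈ Icc (0 : ℝ) 1, e (f x) = h x := fun x hx => by rw [hf1 hx, hecx]
  have g2 : ∀ x ∈ Icc (1 : ℝ) 2, e (f x) = k (x - 1) := fun x hx => by rw [hf2 hx, hecx]
  have hs : ∀ x ∈ Icc (1 : ℝ) 2, x - 1 ∈ Icc (0 : ℝ) 1 :=
    fun x hx => ⟨by linarith [hx.1], by linarith [hx.2]⟩
  have hmix : ∀ x ∈ Icc (0 : ℝ) 1, ∀ y ∈ Icc (1 : ℝ) 2, e (f x) = e (f y) → x = y := by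
    intro x hx y hy hxy
    rw [g1 x hx, g2 y hy] at hxy
    have hz : h x = q := hAB ⟨mem_image_of_mem h hx, hxy ▸ mem_image_of_mem k (hs y hy)⟩
    have h1 : x = 1 := hi hx m1 (hz.trans hq.symm)
    have h2 : y - 1 = 0 := ki (hs y hy) m0 ((hxy.symm.trans hz).trans kq.symm)
    linarith
  have := isArc_image (h := fun x => e (f x)) (s := 0) (t := 2) (by norm_num)
    (he.comp_continuousOn hf) (by
      intro x hx y hy hxy
      rw [← hu] at hx hy
      rcases hx with hx | hx <;> rcases hy with hy | hy
      · exact hi hx hy (by rw [← g1 x hx, ← g1 y hy]; exact hxy)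
      · exact hmix x hx y hy hxy
      · exact (hmix y hy x hx hxy.symm).symm
      · have := ki (hs x hx) (hs y hy) (by rw [← g2 x hx, ← g2 y hy]; exact hxy)
        linarith)
  have h0 : e (f 0) = h 0 := g1 0 m0
  have h2 : e (f 2) = k 1 := by rw [g2 2 ⟨by norm_num, le_rfl⟩]; norm_num
  have himk : k '' Icc 0 1 = (fun x => e (f x)) '' Icc 1 2 := by
    rw [image_congr g2]
    have := image_image k (fun x : ℝ => x - 1) (Icc 1 2)
    rw [← this, image_sub_const_Icc]
    norm_num
  rw [himk, ← image_congr g1, ← image_union, hu, ← h0, ← h2]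
  exact this

lemma exists_first_hit (hA : IsArc A p q) {Y : Set (ℝ × ℝ)} (hY : IsClosed Y) (hp : p ∉ Y)
    (hq : q ∈ Y) : ∃ A' x, A' ⊆ A ∧ x ∈ Y ∧ IsArc A' p x ∧ A' ∩ Y ⊆ {x} := by
  obtain ⟨h, hc, hi, rfl, rfl, rfl⟩ := hA
  have hcl : IsCompact (Icc 0 1 ∩ h ⁻¹' Y) :=
    isCompact_Icc.of_isClosed_subset (hc.preimage_isClosed_of_isClosed isClosed_Icc hY) inter_subset_left
  obtain ⟨s, ⟨hs, hsY⟩, hmin⟩ := hcl.exists_isLeast ⟨1, ⟨zero_le_one, le_rfl⟩, hq⟩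
  have hs0 : 0 < s := hs.1.lt_of_ne (by rintro rfl; exact hp hsY)
  have hsub : Icc 0 s ⊆ Icc (0 : ℝ) 1 := Icc_subset_Icc_right hs.2
  refine ⟨h '' Icc 0 s, h s, image_mono hsub, hsY, isArc_image hs0 (hc.mono hsub) (hi.mono hsub), ?_⟩
  rintro _ ⟨⟨x, hx, rfl⟩, hxY⟩
  have := hmin ⟨hsub hx, hxY⟩
  rw [le_antisymm hx.2 this]
  rfl

end IsArc

lemma isArc_segment {p q : ℝ × ℝ} (hpq : p ≠ q) : IsArc (segment ℝ p q) p q := by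
  refine ⟨AffineMap.lineMap p q, (AffineMap.lineMap_continuous).continuousOn,
    (AffineMap.lineMap_injective ℝ hpq).injOn, by simp, by simp, segment_eq_image_lineMap ℝ p q⟩

/-- A boundary point accessible along a segment is joined to every point of the domain. -/
lemma exists_isArc {W : Set (ℝ × ℝ)} (hW : IsOpen W) (hWc : IsPreconnected W) {w x y : ℝ × ℝ}
    (hw : w ∉ W) (hx : x ∈ W) (hseg : segment ℝ w x ⊆ insert w W) (hy : y ∈ W) :
    ∃ A, IsArc A w y ∧ A ⊆ insert w W := by
  have key : ∀ z ∈ W, ∀ ρ, Metric.closedBall z ρ ⊆ W → ∀ u ∈ Metric.closedBall z ρ,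
      ∀ v ∈ Metric.closedBall z ρ, (∃ A, IsArc A w u ∧ A ⊆ insert w W) →
      ∃ A, IsArc A w v ∧ A ⊆ insert w W := by
    rintro z hz ρ hρ u hu v hv ⟨A, hA, hAW⟩
    obtain ⟨A', x', hA'A, hx', hA', hA'Y⟩ := hA.exists_first_hit Metric.isClosed_closedBall
      (fun h => hw (hρ h)) hu
    by_cases hxv : x' = v
    · exact ⟨A', hxv ▸ hA', hA'A.trans hAW⟩
    · have hsY : segment ℝ x' v ⊆ Metric.closedBall z ρ :=
        (convex_closedBall z ρ).segment_subset hx' hv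
      exact ⟨A' ∪ segment ℝ x' v, hA'.union (isArc_segment hxv)
        fun t ht => hA'Y ⟨ht.1, hsY ht.2⟩,
        union_subset (hA'A.trans hAW) ((hsY.trans hρ).trans (subset_insert _ _))⟩
  have hiff := hWc.induction₂ (fun u v => (∃ A, IsArc A w u ∧ A ⊆ insert w W) ↔
      ∃ A, IsArc A w v ∧ A ⊆ insert w W)
    (by
      intro z hz
      obtain ⟨ρ, hρ, hball⟩ := Metric.nhds_basis_closedBall.mem_iff.1 (hW.mem_nhds hz)
      filter_upwards [mem_nhdsWithin_of_mem_nhds (Metric.closedBall_mem_nhds z hρ)] with v hv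
      have hz' := Metric.mem_closedBall_self (x := z) hρ.le
      exact ⟨key z hz ρ hball z hz' v hv, key z hz ρ hball v hv z hz'⟩)
    (fun _ _ _ _ _ _ h1 h2 => h1.trans h2) (fun _ _ _ _ h => h.symm) hx hy
  exact hiff.1 ⟨_, isArc_segment (by rintro rfl; exact hw hx), hseg⟩

lemma mem_frontier_of_injOn {U : Set (ℝ × ℝ)} (hU : IsOpen U) {g : ℝ → ℝ × ℝ}
    (hc : ContinuousOn g (Icc 0 1)) (hm : ∀ t ∈ Ioo (0 : ℝ) 1, g t ∈ U) {t : ℝ}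
    (ht : t ∈ Icc (0 : ℝ) 1) (htU : g t ∉ U) : g t ∈ frontier U := by
  rw [hU.frontier_eq]
  refine ⟨?_, htU⟩
  have h1 : g t ∈ closure (g '' Ioo 0 1) := by
    have := ContinuousOn.image_closure (s := Ioo (0 : ℝ) 1) (f := g)
      (by rwa [closure_Ioo zero_ne_one])
    rw [closure_Ioo zero_ne_one] at this
    exact this (mem_image_of_mem g ht)
  exact closure_mono (image_subset_iff.2 hm) h1

namespace IsCut

variable {U : Set (ℝ × ℝ)} {g : ℝ → ℝ × ℝ}

/-- Replacing an initial piece of a cut by another arc inside the same small ball. -/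
lemma exists_attach (h : IsCut U g) (hU : IsOpen U) (hsc : SimplyConnectedSpace U)
    {A F C : Set (ℝ × ℝ)} {w p q a : ℝ × ℝ} {s ε : ℝ} (hs : s ∈ Ioo (0 : ℝ) 1)
    (hA : IsArc A w (g s)) (hAg : A ∩ g '' Icc 0 1 ⊆ {g s}) (hAU : A ⊆ insert w U) (hw : w ∉ U)
    (hAa : A ⊆ Metric.ball a ε) (hga : g '' Icc 0 s ⊆ Metric.ball a ε)
    (hF : Disjoint F (g '' Icc 0 1)) (hFa : Disjoint F (Metric.ball a ε))
    (hp : p ∈ F ∩ U) (hq : q ∈ F ∩ U) (hC : IsCompact C) (hCU : C ⊆ U)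
    (hCa : Disjoint C (Metric.ball a ε)) (hqC : q ∈ C)
    {ℓ : ℝ × ℝ → ℂ} (hℓ : ContinuousOn ℓ Cᶜ) (hℓ' : ∀ z ∈ Cᶜ, Complex.exp (ℓ z) = quo p q z) :
    ∃ g', IsCut U g' ∧ InjOn g' (Icc 0 1) ∧ g' 0 = w ∧ g' 1 = g 1 ∧
      Disjoint F (g' '' Icc 0 1) ∧ (g' '' Ioo 0 1 ∩ g '' Ioo 0 1).Nonempty ∧
      (q ∈ connectedComponentIn (U \ g' '' Ioo 0 1) p →
        q ∈ connectedComponentIn (U \ g '' Ioo 0 1) p) := by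
  have hs1 : Icc s 1 ⊆ Icc (0 : ℝ) 1 := Icc_subset_Icc_left hs.1.le
  have hs0 : Icc 0 s ⊆ Icc (0 : ℝ) 1 := Icc_subset_Icc_right hs.2.le
  have hgs : g s ∈ U := h.mem s hs
  have hs1' : Icc s 1 ⊆ Ioc (0 : ℝ) 1 := fun x hx => ⟨hs.1.trans_le hx.1, hx.2⟩
  have hB := isArc_image hs.2 (h.cont.mono hs1) ((h.injOn_Ioc hU).mono hs1')
  obtain ⟨g', hc', hi', h0', h1', him⟩ := hA.union hB
    ((inter_subset_inter_right A (image_mono hs1)).trans hAg)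
  have m0 : (0 : ℝ) ∈ Icc (0 : ℝ) 1 := ⟨le_rfl, zero_le_one⟩
  have m1 : (1 : ℝ) ∈ Icc (0 : ℝ) 1 := ⟨zero_le_one, le_rfl⟩
  have hg1 : g 1 ∉ U := notMem_of_mem_frontier hU h.right
  have hmem : ∀ t ∈ Ioo (0 : ℝ) 1, g' t ∈ U := by
    intro t ht
    have hw' : g' t ≠ w := fun e => ht.1.ne' (hi' (Ioo_subset_Icc_self ht) m0 (e.trans h0'.symm))
    have hg' : g' t ≠ g 1 := fun e => ht.2.ne (hi' (Ioo_subset_Icc_self ht) m1 (e.trans h1'.symm))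
    have : g' t ∈ A ∪ g '' Icc s 1 := by
      rw [him]
      exact mem_image_of_mem g' (Ioo_subset_Icc_self ht)
    rcases this with hh | ⟨x, hx, hxe⟩
    · exact (hAU hh).resolve_left hw'
    · rw [← hxe]
      refine h.mem x ⟨hs.1.trans_le hx.1, hx.2.lt_of_ne ?_⟩
      rintro rfl
      exact hg' hxe.symm
  have h' : IsCut U g' := ⟨hc', hi'.mono Ioo_subset_Icc_self, hmem,
    mem_frontier_of_injOn hU hc' hmem m0 (h0' ▸ hw), mem_frontier_of_injOn hU hc' hmem m1 (h1' ▸ hg1)⟩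
  have hF' : Disjoint F (g' '' Icc 0 1) := by
    rw [← him]
    exact (hFa.mono_right hAa).union_right (hF.mono_right (image_mono hs1))
  refine ⟨g', h', hi', h0', h1', hF', ?_, fun hqp => ?_⟩
  · obtain ⟨t, ht, hte⟩ := him.subset (Or.inl hA.right_mem)
    exact ⟨g s, ⟨t, h'.mem_Ioo hU ht (hte ▸ hgs), hte⟩, ⟨s, hs, rfl⟩⟩
  have hop' := h'.isOpen_sdiff hU
  have hpF : p ∈ U \ g' '' Ioo 0 1 :=
    ⟨hp.2, fun hh => hF'.le_bot ⟨hp.1, image_mono Ioo_subset_Icc_self hh⟩⟩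
  obtain ⟨C', hC', hCD', hpC', hqC', k, hk, hk'⟩ := exists_log_compl (hop'.connectedComponentIn (x := p))
    isPreconnected_connectedComponentIn (mem_connectedComponentIn hpF) hqp
  have hC'U : C' ⊆ U \ g' '' Ioo 0 1 := hCD'.trans (connectedComponentIn_subset _ _)
  have hsubC : (C ∪ C')ᶜ ⊆ Cᶜ := compl_subset_compl.2 subset_union_left
  have hsubC' : (C ∪ C')ᶜ ⊆ C'ᶜ := compl_subset_compl.2 subset_union_right
  have hψ1 : ∀ z ∈ (C ∪ C')ᶜ, Complex.exp (k z - ℓ z) = 1 := fun z hz => by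
    rw [Complex.exp_sub, hk' z (hsubC' hz), hℓ' z (hsubC hz), div_self]
    rw [← hℓ' z (hsubC hz)]
    exact Complex.exp_ne_zero _
  have hψc : ContinuousOn (fun z => k z - ℓ z) (C ∪ C')ᶜ := (hk.mono hsubC').sub (hℓ.mono hsubC)
  obtain ⟨R₀, v, hR₀, hv⟩ := exists_const_of_exp_eq_one hU hsc (hC.union hC')
    (union_subset hCU fun z hz => (hC'U hz).1) hψc hψ1
  have hgC' : ∀ z ∈ g' '' Icc 0 1, z ∉ C' := by
    rintro _ ⟨t, ht, rfl⟩ hz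
    exact (hC'U hz).2 ⟨t, h'.mem_Ioo hU ht (hC'U hz).1, rfl⟩
  have hAC : A ⊆ (C ∪ C')ᶜ := by
    rintro z hz (hz' | hz')
    · exact hCa.le_bot ⟨hz', hAa hz⟩
    · exact hgC' z (him ▸ Or.inl hz) hz'
  have hvs : k (g s) - ℓ (g s) = v := by
    rw [← hv w (Or.inl hw)]
    exact eq_of_exp_eq_one hA.isPreconnected (hψc.mono hAC) (fun z hz => hψ1 z (hAC hz))
      hA.right_mem hA.left_mem
  have hexpv : Complex.exp v = 1 := by
    rw [← hvs]
    exact hψ1 _ (hAC hA.right_mem)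
  obtain ⟨R₁, hR₁⟩ := exists_disjoint_far h.isCompact.isBounded
  set R := max R₀ R₁
  have hRR₀ : far R ⊆ far R₀ := fun z (hz : R ≤ ‖z‖) => show R₀ ≤ ‖z‖ from (le_max_left _ _).trans hz
  have hRR₁ : far R ⊆ far R₁ := fun z (hz : R ≤ ‖z‖) => show R₁ ≤ ‖z‖ from (le_max_right _ _).trans hz
  have hcl : IsClosed (Uᶜ ∪ far R) := hU.isClosed_compl.union (isClosed_far R)
  have hAcl : IsClosed (g '' Icc 0 s) := (isCompact_Icc.image_of_continuousOn (h.cont.mono hs0)).isClosed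
  have hBcl : IsClosed (g '' Icc s 1) := (isCompact_Icc.image_of_continuousOn (h.cont.mono hs1)).isClosed
  have hZC : (Uᶜ ∪ far R) ∪ g '' Icc 0 s ⊆ Cᶜ := by
    rintro z ((hz | hz) | hz) hzC
    · exact hz (hCU hzC)
    · exact hR₀.le_bot ⟨Or.inl hzC, hRR₀ hz⟩
    · exact hCa.le_bot ⟨hzC, hga hz⟩
  have hBC : g '' Icc s 1 ⊆ C'ᶜ := fun z hz => hgC' z (him ▸ Or.inr hz)
  obtain ⟨m, hm, hml, hmr⟩ := exists_union (hcl.union hAcl) hBcl (hℓ.mono hZC)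
    (m := fun z => k z - v) ((hk.mono hBC).sub continuousOn_const) (by
      rintro z hz ⟨x, hx, rfl⟩
      suffices k (g x) - ℓ (g x) = v by rw [← this]; ring
      by_cases hxU : g x ∈ U
      · rcases hz with (hz | hz) | ⟨y, hy, hyx⟩
        · exact absurd hxU hz
        · exact hv _ (Or.inr (hRR₀ hz))
        · have hxI := h.mem_Ioo hU (hs1 hx) hxU
          have hyI := h.mem_Ioo hU (hs0 hy) (hyx ▸ hxU)
          have hxy := h.inj hyI hxI hyx
          have hxs : x = s := le_antisymm (hxy ▸ hy.2) hx.1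
          rw [hxs, hvs]
      · exact hv _ (Or.inl hxU))
  have hZeq : ((Uᶜ ∪ far R) ∪ g '' Icc 0 s) ∪ g '' Icc s 1 = (Uᶜ ∪ g '' Icc 0 1) ∪ far R := by
    rw [union_assoc, ← image_union, Icc_union_Icc_eq_Icc hs.1.le hs.2.le, union_right_comm]
  have hnZ : ∀ x ∈ F ∩ U, x ∉ Uᶜ ∪ g '' Icc 0 1 := by
    rintro x hx (hx' | hx')
    · exact hx' hx.2
    · exact hF.le_bot ⟨hx.1, hx'⟩
  rw [hZeq] at hm
  rw [h.sdiff_eq hU]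
  refine mem_connectedComponentIn_of_log (h.isClosed hU) (hnZ p hp) (hnZ q hq)
    (fun hh => hR₀.le_bot ⟨Or.inl hqC, hRR₀ hh⟩) hm ?_
  rw [← hZeq]
  rintro z (hz | hz)
  · rw [hml hz, hℓ' z (hZC hz)]
  · rw [hmr hz, Complex.exp_sub, hexpv, div_one, hk' z (hBC hz)]

end IsCut

namespace IsCut

variable {U : Set (ℝ × ℝ)} {g : ℝ → ℝ × ℝ}

lemma exists_ball_subset (h : IsCut U g) (hU : IsOpen U) {ε : ℝ} (hε : 0 < ε) :
    ∃ ε' > 0, ε' ≤ ε ∧ ∀ s ∈ Ioo (0 : ℝ) 1, g s ∈ Metric.ball (g 0) ε' →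
      g '' Icc 0 s ⊆ Metric.ball (g 0) ε ∨ (g 1 = g 0 ∧ g '' Icc s 1 ⊆ Metric.ball (g 0) ε) := by
  have near : ∀ {k : ℝ → ℝ × ℝ}, ContinuousOn k (Icc 0 1) → ∃ δ > 0, ∀ t ∈ Icc (0 : ℝ) 1, t < δ →
      k t ∈ Metric.ball (k 0) ε := by
    intro k hk
    obtain ⟨δ, hδ, hδ'⟩ := Metric.continuousWithinAt_iff.1 (hk 0 ⟨le_rfl, zero_le_one⟩) ε hε
    refine ⟨δ, hδ, fun t ht htδ => hδ' ht ?_⟩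
    rwa [Real.dist_eq, sub_zero, abs_of_nonneg ht.1]
  obtain ⟨δ, hδ, hδ'⟩ := near h.cont
  obtain ⟨c, hc1, hc, hcs⟩ : ∃ c ≤ (1 : ℝ), (g 0 ∉ g '' Icc δ c) ∧ ∀ s ∈ Ioo (0 : ℝ) 1, c < s →
      g 1 = g 0 ∧ g '' Icc s 1 ⊆ Metric.ball (g 0) ε := by
    have h0 := notMem_of_mem_frontier hU h.left
    by_cases h01 : g 1 = g 0
    · obtain ⟨δ₁, hδ₁, hδ₁'⟩ := near h.symm.cont
      refine ⟨1 - δ₁, by linarith, ?_, fun s hs hcs => ⟨h01, ?_⟩⟩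
      · rintro ⟨t, ht, hte⟩
        exact h0 (hte ▸ h.mem t ⟨by linarith [ht.1], by linarith [ht.2]⟩)
      · rintro _ ⟨t, ht, rfl⟩
        have := hδ₁' (1 - t) ⟨by linarith [ht.2], by linarith [ht.1, hs.1]⟩ (by linarith [ht.1])
        simpa [h01] using this
    · refine ⟨1, le_rfl, ?_, fun s hs hcs => absurd hs.2 hcs.not_gt⟩
      rintro ⟨t, ht, hte⟩
      rcases ht.2.eq_or_lt with rfl | ht1
      · exact h01 hte
      · exact h0 (hte ▸ h.mem t ⟨by linarith [ht.1], ht1⟩)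
  have hcomp : IsClosed (g '' Icc δ c) := (isCompact_Icc.image_of_continuousOn
    (h.cont.mono (Icc_subset_Icc hδ.le hc1))).isClosed
  obtain ⟨r, hr, hr'⟩ := Metric.isOpen_iff.1 hcomp.isOpen_compl _ hc
  refine ⟨min r ε, lt_min hr hε, min_le_right _ _, fun s hs hsb => ?_⟩
  by_cases hsc : c < s
  · exact Or.inr (hcs s hs hsc)
  · left
    have hsδ : s < δ := by
      by_contra hsδ
      exact hr' (Metric.ball_subset_ball (min_le_left _ _) hsb) ⟨s, ⟨not_lt.1 hsδ, not_lt.1 hsc⟩, rfl⟩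
    rintro _ ⟨t, ht, rfl⟩
    exact hδ' t ⟨ht.1, ht.2.trans hs.2.le⟩ (ht.2.trans_lt hsδ)

end IsCut

/-- Close to a frontier point of a convex piece of `U` there is a point of `Uᶜ` accessible along a
segment. -/
lemma exists_accessible {U B : Set (ℝ × ℝ)} (hU : IsOpen U) (hB : IsOpen B) (hBc : Convex ℝ B)
    {y w : ℝ × ℝ} (hw : w ∈ frontier (connectedComponentIn (U ∩ B) y)) (hwB : w ∈ B)
    {T : Set (ℝ × ℝ)} (hT : IsClosed T) (hwT : w ∉ T) :
    ∃ w' x, w' ∉ U ∧ w' ∈ B ∧ w' ∉ T ∧ x ∈ connectedComponentIn (U ∩ B) y ∧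
      segment ℝ w' x ⊆ insert w' (connectedComponentIn (U ∩ B) y) := by
  set W := connectedComponentIn (U ∩ B) y with hWdef
  have hWUB : W ⊆ U ∩ B := connectedComponentIn_subset _ _
  have hwU : w ∉ U := fun hwU => frontier_connectedComponentIn_subset (hU.inter hB) y hw ⟨hwU, hwB⟩
  obtain ⟨η, hη, hηB⟩ := Metric.isOpen_iff.1 (hB.inter hT.isOpen_compl) w ⟨hwB, hwT⟩
  obtain ⟨x, hxW, hxw⟩ := Metric.mem_closure_iff.1 (frontier_subset_closure hw) (η / 2) (half_pos hη)
  obtain ⟨w', hw'U, hw'⟩ := hU.isClosed_compl.exists_infDist_eq_dist ⟨w, hwU⟩ x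
  have hle : ∀ z ∉ U, dist x w' ≤ dist x z := fun z hz => hw' ▸ Metric.infDist_le_dist_of_mem hz
  have hw'η : w' ∈ Metric.ball w η := by
    have := hle w hwU
    have h2 := dist_triangle w' x w
    rw [Metric.mem_ball]
    rw [dist_comm w' x] at h2
    rw [dist_comm w x] at hxw
    linarith
  have hr : 0 < dist x w' := dist_pos.2 fun e => hw'U (e ▸ (hWUB hxW).1)
  refine ⟨w', x, hw'U, (hηB hw'η).1, (hηB hw'η).2, hxW, ?_⟩
  have hS : segment ℝ w' x ∩ Metric.ball x (dist x w') ⊆ W := by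
    rw [hWdef, connectedComponentIn_eq hxW]
    refine IsPreconnected.subset_connectedComponentIn
      ((convex_segment w' x).inter (convex_ball x _)).isPreconnected
      ⟨right_mem_segment ℝ _ _, Metric.mem_ball_self hr⟩ ?_
    rintro z ⟨hz, hzb⟩
    refine ⟨?_, hBc.segment_subset (hηB hw'η).1 (hWUB hxW).2 hz⟩
    by_contra hzU
    have := hle z hzU
    rw [Metric.mem_ball, dist_comm] at hzb
    linarith
  intro z hz
  by_cases hzw : z = w'
  · exact Or.inl hzw
  · refine Or.inr (hS ⟨hz, ?_⟩)
    rw [segment_eq_image_lineMap] at hz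
    obtain ⟨θ, hθ, rfl⟩ := hz
    have hθ0 : 0 < θ := hθ.1.lt_of_ne (by rintro rfl; simp at hzw)
    rw [Metric.mem_ball, dist_lineMap_right, Real.norm_of_nonneg (by linarith [hθ.2]), dist_comm w' x]
    nlinarith

namespace IsCut

variable {U : Set (ℝ × ℝ)} {g : ℝ → ℝ × ℝ}

/-- The initial point of a cut can be moved off a closed totally disconnected set, without
connecting given points that the cut separates. -/
lemma exists_move (h : IsCut U g) (hU : IsOpen U) (hsc : SimplyConnectedSpace U)
    {F T : Set (ℝ × ℝ)} (hFc : IsClosed F) (hF : Disjoint F (g '' Icc 0 1)) {p q : ℝ × ℝ}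
    (hp : p ∈ F ∩ U) (hq : q ∈ F ∩ U) (hTc : IsClosed T) (hT : IsTotallyDisconnected T) :
    ∃ g', IsCut U g' ∧ InjOn g' (Icc 0 1) ∧ g' 0 ∉ T ∧ g' 1 = g 1 ∧
      Disjoint F (g' '' Icc 0 1) ∧ (g' '' Ioo 0 1 ∩ g '' Ioo 0 1).Nonempty ∧
      (q ∈ connectedComponentIn (U \ g' '' Ioo 0 1) p →
        q ∈ connectedComponentIn (U \ g '' Ioo 0 1) p) := by
  have m0 : (0 : ℝ) ∈ Icc (0 : ℝ) 1 := ⟨le_rfl, zero_le_one⟩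
  have h0U := notMem_of_mem_frontier hU h.left
  have hUc := isPreconnected_of_simplyConnectedSpace hsc
  obtain ⟨C, hC, hCU, hpC, hqC, ℓ, hℓ, hℓ'⟩ := exists_log_compl hU hUc hp.2 hq.2
  obtain ⟨ε, hε, hεb⟩ := Metric.isOpen_iff.1 (hFc.union hC.isClosed).isOpen_compl (g 0) (by
    rintro (hh | hh)
    · exact hF.le_bot ⟨hh, mem_image_of_mem g m0⟩
    · exact h0U (hCU hh))
  have hFa : Disjoint F (Metric.ball (g 0) ε) :=
    disjoint_left.2 fun z hz hz' => hεb hz' (Or.inl hz)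
  have hCa : Disjoint C (Metric.ball (g 0) ε) :=
    disjoint_left.2 fun z hz hz' => hεb hz' (Or.inr hz)
  obtain ⟨ε', hε', hε'ε, hball⟩ := h.exists_ball_subset hU hε
  obtain ⟨t₀, ht₀, ht₀b⟩ : ∃ t ∈ Ioo (0 : ℝ) 1, g t ∈ Metric.ball (g 0) ε' := by
    obtain ⟨δ, hδ, hδ'⟩ := Metric.continuousWithinAt_iff.1 (h.cont 0 m0) ε' hε'
    have hpos : 0 < min δ 1 := lt_min hδ one_pos
    have h1 := min_le_left δ 1
    have h2 := min_le_right δ 1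
    refine ⟨min δ 1 / 2, ⟨by linarith, by linarith⟩, hδ' ⟨by linarith, by linarith⟩ ?_⟩
    rw [Real.dist_eq, sub_zero, abs_of_pos (by linarith)]
    linarith
  set B := Metric.ball (g 0) ε' with hB
  set W := connectedComponentIn (U ∩ B) (g t₀) with hW
  have hUB : IsOpen (U ∩ B) := hU.inter Metric.isOpen_ball
  have hWU : W ⊆ U ∩ B := connectedComponentIn_subset _ _
  have ht₀W : g t₀ ∈ W := mem_connectedComponentIn ⟨h.mem t₀ ht₀, ht₀b⟩
  set T' := insert (g 1) (insert (g 0) T) with hT'def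
  have hTc0 : IsClosed (insert (g 0) T) := isClosed_singleton.union hTc
  have hT'c : IsClosed T' := isClosed_singleton.union hTc0
  have hT' : IsTotallyDisconnected T' :=
    isTotallyDisconnected_insert (isTotallyDisconnected_insert hT hTc (g 0)) hTc0 (g 1)
  obtain ⟨w₀, hw₀, hw₀B, hw₀T⟩ := exists_mem_frontier_notMem hU hsc hUB.connectedComponentIn
    (hWU.trans inter_subset_left) hT' h0U ⟨g t₀, ht₀b, ht₀W⟩
  obtain ⟨w, x, hwU, hwB, hwT, hxW, hseg⟩ := exists_accessible hU Metric.isOpen_ball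
    (convex_ball _ _) hw₀ hw₀B hT'c hw₀T
  obtain ⟨A, hA, hAW⟩ := exists_isArc hUB.connectedComponentIn isPreconnected_connectedComponentIn
    (fun hh => hwU (hWU hh).1) hxW hseg ht₀W
  have hwY : w ∉ g '' Icc 0 1 := by
    rintro ⟨t, ht, rfl⟩
    rcases ht.1.eq_or_lt with rfl | ht0
    · exact hwT (Or.inr (Or.inl rfl))
    rcases ht.2.eq_or_lt with rfl | ht1
    · exact hwT (Or.inl rfl)
    exact hwU (h.mem t ⟨ht0, ht1⟩)
  obtain ⟨A', _, hA'A, ⟨s, hs, rfl⟩, hA', hA'Y⟩ := hA.exists_first_hit h.isCompact.isClosed hwY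
    ⟨t₀, Ioo_subset_Icc_self ht₀, rfl⟩
  have hgsW : g s ∈ W := (hAW (hA'A hA'.right_mem)).resolve_left fun e =>
    hwY (e ▸ mem_image_of_mem g hs)
  have hsI := h.mem_Ioo hU hs (hWU hgsW).1
  have hA'U : A' ⊆ insert w U := fun z hz => (hAW (hA'A hz)).imp_right fun hh => (hWU hh).1
  have hBε : B ⊆ Metric.ball (g 0) ε := Metric.ball_subset_ball hε'ε
  have hA'a : A' ⊆ Metric.ball (g 0) ε := fun z hz => by
    rcases hAW (hA'A hz) with rfl | hh
    · exact hBε hwB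
    · exact hBε (hWU hh).2
  have hwT0 : w ∉ T := fun hh => hwT (Or.inr (Or.inr hh))
  rcases hball s hsI (hWU hgsW).2 with hcase | ⟨h10, hcase⟩
  · obtain ⟨g', h1, h2, h3, h4, h5⟩ := h.exists_attach hU hsc hsI hA' hA'Y hA'U hwU hA'a hcase hF hFa
      hp hq hC hCU hCa hqC hℓ hℓ'
    exact ⟨g', h1, h2, h3 ▸ hwT0, h4, h5⟩
  · have h1s : 1 - s ∈ Ioo (0 : ℝ) 1 := ⟨by linarith [hsI.2], by linarith [hsI.1]⟩
    have hgs : g (1 - (1 - s)) = g s := by rw [sub_sub_cancel]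
    have hcase' : (fun t => g (1 - t)) '' Icc 0 (1 - s) ⊆ Metric.ball (g 0) ε := by
      rintro _ ⟨t, ht, rfl⟩
      exact hcase ⟨1 - t, ⟨by linarith [ht.2], by linarith [ht.1]⟩, rfl⟩
    obtain ⟨g', h1, h2, h3, h4, h5⟩ := h.symm.exists_attach hU hsc h1s (hgs.symm ▸ hA')
      (by rw [image_symm_Icc, hgs]; exact hA'Y) hA'U hwU hA'a hcase'
      (by rwa [image_symm_Icc]) hFa hp hq hC hCU hCa hqC hℓ hℓ'
    rw [image_symm_Ioo] at h5
    refine ⟨g', h1, h2, h3 ▸ hwT0, ?_, h5⟩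
    rw [h4, sub_self, h10]

/-- Both endpoints of a cut can be moved off a closed totally disconnected set. -/
lemma exists_move_both (h : IsCut U g) (hU : IsOpen U) (hsc : SimplyConnectedSpace U)
    {F T : Set (ℝ × ℝ)} (hFc : IsClosed F) (hF : Disjoint F (g '' Icc 0 1)) {p q : ℝ × ℝ}
    (hp : p ∈ F ∩ U) (hq : q ∈ F ∩ U) (hTc : IsClosed T) (hT : IsTotallyDisconnected T) :
    ∃ g' J, IsCut U g' ∧ InjOn g' (Icc 0 1) ∧ g' 0 ∉ T ∧ g' 1 ∉ T ∧
      Disjoint F (g' '' Icc 0 1) ∧ IsPreconnected J ∧ J ⊆ U ∧ Disjoint F J ∧ g' '' Ioo 0 1 ⊆ J ∧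
      (J ∩ g '' Ioo 0 1).Nonempty ∧
      (q ∈ connectedComponentIn (U \ g' '' Ioo 0 1) p →
        q ∈ connectedComponentIn (U \ g '' Ioo 0 1) p) := by
  have hpre : ∀ {k}, IsCut U k → IsPreconnected (k '' Ioo 0 1) := fun hk =>
    isPreconnected_Ioo.image _ (hk.cont.mono Ioo_subset_Icc_self)
  obtain ⟨k, hk, -, hk0, -, hkF, ⟨y, hyk, hyg⟩, hkc⟩ := h.exists_move hU hsc hFc hF hp hq hTc hT
  obtain ⟨g', h1, h2, h3, h4, h5, ⟨z, hzg, hzk⟩, h7⟩ := hk.symm.exists_move hU hsc hFc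
    (by rwa [image_symm_Icc]) hp hq hTc hT
  rw [image_symm_Ioo] at hzk h7
  refine ⟨g', g' '' Ioo 0 1 ∪ k '' Ioo 0 1, h1, h2, h3, ?_, h5,
    (hpre h1).union z hzg hzk (hpre hk), union_subset (image_subset_iff.2 h1.mem)
    (image_subset_iff.2 hk.mem), ?_, subset_union_left, ⟨y, Or.inr hyk, hyg⟩, fun hh => hkc (h7 hh)⟩
  · rw [h4, sub_self]
    exact hk0
  · exact (h5.mono_right (image_mono Ioo_subset_Icc_self)).union_right
      (hkF.mono_right (image_mono Ioo_subset_Icc_self))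

end IsCut

lemma _root_.IsCompOf.nonempty {Y : Type*} [TopologicalSpace Y] {A D : Set Y} (h : IsCompOf A D) :
    D.Nonempty := by
  obtain ⟨x, hx, rfl⟩ := h
  exact ⟨x, mem_connectedComponentIn hx⟩

lemma _root_.IsCompOf.subset {Y : Type*} [TopologicalSpace Y] {A D : Set Y} (h : IsCompOf A D) :
    D ⊆ A := by
  obtain ⟨x, hx, rfl⟩ := h
  exact connectedComponentIn_subset _ _

lemma _root_.IsCompOf.eq_of_mem {Y : Type*} [TopologicalSpace Y] {A D : Set Y} (h : IsCompOf A D) {x : Y}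
    (hx : x ∈ D) : D = connectedComponentIn A x := by
  obtain ⟨y, hy, rfl⟩ := h
  exact connectedComponentIn_eq hx

lemma _root_.IsCompOf.eq_of_mem_of_mem {Y : Type*} [TopologicalSpace Y] {A D E : Set Y}
    (h : IsCompOf A D) (h' : IsCompOf A E) {x : Y} (hx : x ∈ D) (hx' : x ∈ E) : D = E := by
  rw [h.eq_of_mem hx, h'.eq_of_mem hx']

lemma _root_.IsCompOf.isPreconnected {Y : Type*} [TopologicalSpace Y] {A D : Set Y} (h : IsCompOf A D) :
    IsPreconnected D := by
  obtain ⟨y, hy, rfl⟩ := h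
  exact isPreconnected_connectedComponentIn

lemma _root_.IsCompOf.subset_of_isPreconnected {Y : Type*} [TopologicalSpace Y] {A D J : Set Y}
    (h : IsCompOf A D) (hJ : IsPreconnected J) (hJA : J ⊆ A) (hJD : (J ∩ D).Nonempty) : J ⊆ D := by
  obtain ⟨x, hx, hxD⟩ := hJD
  rw [h.eq_of_mem hxD]
  exact hJ.subset_connectedComponentIn hx hJA

lemma _root_.IsCompOf.isOpen {A D : Set (ℝ × ℝ)} (h : IsCompOf A D) (hA : IsOpen A) : IsOpen D := by
  obtain ⟨y, hy, rfl⟩ := h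
  exact hA.connectedComponentIn

lemma _root_.IsCompOf.mem_of_mem_closure {A D : Set (ℝ × ℝ)} (h : IsCompOf A D) (hA : IsOpen A)
    {x : ℝ × ℝ} (hx : x ∈ A) (hxD : x ∈ closure D) : x ∈ D := by
  obtain ⟨y, hy, rfl⟩ := h
  by_contra hxy
  exact notMem_closure_connectedComponentIn hA hx hxy hxD

/-- The sides of a cross-cut whose endpoints and distinguished boundary points avoid `T`. -/
structure IsSide (U T : Set (ℝ × ℝ)) (g : ℝ → ℝ × ℝ) (D E : Set (ℝ × ℝ)) : Prop where
  cut : IsCut U g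
  left_notMem : g 0 ∉ T
  right_notMem : g 1 ∉ T
  two : HasTwoComps (U \ g '' Ioo 0 1) D E
  front : (frontier D ∩ (frontier U \ g '' Icc 0 1) ∩ Tᶜ).Nonempty
  front' : (frontier E ∩ (frontier U \ g '' Icc 0 1) ∩ Tᶜ).Nonempty

/-- A cross-section cut off by a cross-cut as in `IsSide`. -/
def IsSectionOff (U T D : Set (ℝ × ℝ)) : Prop := ∃ g E, IsSide U T g D E

lemma isCrossSection_iff {U D : Set (ℝ × ℝ)} : IsCrossSection U D ↔ IsSectionOff U ∅ D := by
  constructor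
  · rintro ⟨γ, ⟨g, hc, hi, hm, h0, h1, rfl, D₁, D₂, h2, hf1, hf2⟩, x, hx, rfl⟩
    have hcut : IsCut U g := ⟨hc, hi, hm, h0, h1⟩
    rcases h2.2.2.2 x hx with h | h <;> rw [h]
    · exact ⟨g, D₂, hcut, notMem_empty _, notMem_empty _, h2, by simpa using hf1, by simpa using hf2⟩
    · exact ⟨g, D₁, hcut, notMem_empty _, notMem_empty _,
        ⟨h2.2.1, h2.1, h2.2.2.1.symm, fun x hx => (h2.2.2.2 x hx).symm⟩,
        by simpa using hf2, by simpa using hf1⟩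
  · rintro ⟨g, E, h, -, -, h2, hf1, hf2⟩
    exact ⟨_, ⟨g, h.cont, h.inj, h.mem, h.left, h.right, rfl, D, E, h2, by simpa using hf1,
      by simpa using hf2⟩, h2.1⟩

lemma IsSectionOff.isCrossSection {U T D : Set (ℝ × ℝ)} (h : IsSectionOff U T D) :
    IsCrossSection U D := by
  obtain ⟨g, E, h⟩ := h
  exact isCrossSection_iff.2 ⟨g, E, h.cut, notMem_empty _, notMem_empty _, h.two,
    h.front.mono fun x hx => ⟨hx.1, notMem_empty x⟩, h.front'.mono fun x hx => ⟨hx.1, notMem_empty x⟩⟩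

lemma IsSide.closure_bdIn {U T : Set (ℝ × ℝ)} {g : ℝ → ℝ × ℝ} {D E : Set (ℝ × ℝ)}
    (h : IsSide U T g D E) (hU : IsOpen U) (hsc : SimplyConnectedSpace U) :
    closure (bdIn U D) = g '' Icc 0 1 := by
  rw [h.cut.bdIn_eq hU hsc h.two.1, h.cut.closure_image]

lemma exists_frontier_inter {U T D D' : Set (ℝ × ℝ)} {k g : ℝ → ℝ × ℝ} (hU : IsOpen U)
    (hsc : SimplyConnectedSpace U) (hk : IsCut U k) (hg : IsCut U g)
    (hD : IsCompOf (U \ k '' Ioo 0 1) D)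
    (hz : (frontier D ∩ (frontier U \ k '' Icc 0 1)).Nonempty) (hDD' : D ⊆ D') (hD'U : D' ⊆ U)
    (hD' : IsOpen D') (hTc : IsClosed T) (hT : IsTotallyDisconnected T) :
    (frontier D' ∩ (frontier U \ g '' Icc 0 1) ∩ Tᶜ).Nonempty := by
  obtain ⟨z, hzD, hzU, hzk⟩ := hz
  obtain ⟨r, hr, hrk⟩ := Metric.isOpen_iff.1 hk.isCompact.isClosed.isOpen_compl z hzk
  have hDo := hD.isOpen (hk.isOpen_sdiff hU)
  have hTc0 : IsClosed (insert (g 0) T) := isClosed_singleton.union hTc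
  obtain ⟨w, hwD, hwr, hwT⟩ := exists_mem_frontier_notMem hU hsc hDo
    (hDD'.trans hD'U) (isTotallyDisconnected_insert (isTotallyDisconnected_insert hT hTc (g 0)) hTc0
      (g 1)) (notMem_of_mem_frontier hU hzU)
    (mem_closure_iff.1 (frontier_subset_closure hzD) _ Metric.isOpen_ball (Metric.mem_ball_self hr))
  have hwU : w ∉ U := fun hwU => by
    refine notMem_of_mem_frontier hDo hwD (hD.mem_of_mem_closure (hk.isOpen_sdiff hU) ⟨hwU, ?_⟩
      (frontier_subset_closure hwD))
    exact fun hh => hrk hwr (image_mono Ioo_subset_Icc_self hh)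
  have hwD' : w ∈ closure D' := closure_mono hDD' (frontier_subset_closure hwD)
  refine ⟨w, ⟨?_, ?_, ?_⟩, fun hh => hwT (Or.inr (Or.inr hh))⟩
  · rw [hD'.frontier_eq]
    exact ⟨hwD', fun hh => hwU (hD'U hh)⟩
  · rw [hU.frontier_eq]
    exact ⟨closure_mono hD'U hwD', hwU⟩
  · rintro ⟨t, ht, rfl⟩
    rcases ht.1.eq_or_lt with rfl | ht0
    · exact hwT (Or.inr (Or.inl rfl))
    rcases ht.2.eq_or_lt with rfl | ht1
    · exact hwT (Or.inl rfl)
    exact hwU (hg.mem t ⟨ht0, ht1⟩)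

/-- If a cross-section is contained in another one, so is its relative boundary, provided the
boundaries are disjoint. -/
lemma IsSide.image_subset {U T T' D E D' E' : Set (ℝ × ℝ)} {g g' : ℝ → ℝ × ℝ} (hU : IsOpen U)
    (hsc : SimplyConnectedSpace U) (h : IsSide U T g D E) (h' : IsSide U T' g' D' E') (hDD' : D ⊆ D')
    (hdisj : Disjoint (g '' Icc 0 1) (g' '' Icc 0 1)) : g '' Ioo 0 1 ⊆ D' := by
  intro y hy
  have hyU : y ∈ U := (image_subset_iff.2 h.cut.mem) hy
  refine h'.two.1.mem_of_mem_closure (h'.cut.isOpen_sdiff hU) ⟨hyU, fun hh => ?_⟩ (closure_mono hDD' ?_)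
  · exact hdisj.le_bot ⟨image_mono Ioo_subset_Icc_self hy, image_mono Ioo_subset_Icc_self hh⟩
  · rw [← h.cut.bdIn_eq hU hsc h.two.1] at hy
    exact hy.1.1

/-- Between two cross-sections with room for a third one there is a cross-section whose cross-cut
ends off a given closed totally disconnected set. -/
theorem exists_isSectionOff_between {U T : Set (ℝ × ℝ)} (hU : IsOpen U) (hsc : SimplyConnectedSpace U)
    (hTc : IsClosed T) (hT : IsTotallyDisconnected T) {D₀ D₁ D₂ F : Set (ℝ × ℝ)}
    (h₀ : IsCrossSection U D₀) (h₁ : IsCrossSection U D₁) (h₂ : IsCrossSection U D₂)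
    (h10 : D₁ ⊆ D₀) (h21 : D₂ ⊆ D₁)
    (d01 : Disjoint (closure (bdIn U D₀)) (closure (bdIn U D₁)))
    (d12 : Disjoint (closure (bdIn U D₁)) (closure (bdIn U D₂)))
    (hF : IsClosed F) (hFd : Disjoint F (closure (bdIn U D₁))) :
    ∃ D, IsSectionOff U T D ∧ D₂ ⊆ D ∧ D ⊆ D₀ ∧ Disjoint F (closure (bdIn U D)) ∧
      (closure (bdIn U D) \ U).Finite ∧ Disjoint D₂ (bdIn U D) := by
  obtain ⟨g₀, E₀, s₀⟩ := isCrossSection_iff.1 h₀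
  obtain ⟨g₁, E₁, s₁⟩ := isCrossSection_iff.1 h₁
  obtain ⟨g₂, E₂, s₂⟩ := isCrossSection_iff.1 h₂
  rw [s₁.closure_bdIn hU hsc] at d01 d12 hFd
  rw [s₀.closure_bdIn hU hsc] at d01
  rw [s₂.closure_bdIn hU hsc] at d12
  have o₀ := s₀.cut.isOpen_sdiff hU
  have hγ1 : g₁ '' Ioo 0 1 ⊆ D₀ := s₁.image_subset hU hsc s₀ h10 d01.symm
  obtain ⟨p, hp⟩ := s₂.two.1.nonempty
  obtain ⟨q, hq⟩ := s₀.two.2.1.nonempty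
  have hpU : p ∈ U := (s₂.two.1.subset hp).1
  have hqU : q ∈ U := (s₀.two.2.1.subset hq).1
  have hqD₀ : q ∉ D₀ := fun hh => s₀.two.2.2.1 (s₀.two.1.eq_of_mem_of_mem s₀.two.2.1 hh hq)
  have hp1 : p ∈ U \ g₁ '' Ioo 0 1 := s₁.two.1.subset (h21 hp)
  have hq1 : q ∈ U \ g₁ '' Ioo 0 1 := ⟨hqU, fun hh => hqD₀ (hγ1 hh)⟩
  have nIcc : ∀ {x}, x ∈ U \ g₁ '' Ioo 0 1 → x ∉ g₁ '' Icc 0 1 := fun hx hh =>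
    s₁.cut.mem_compl_sdiff hU hx (Or.inr hh)
  set G := F ∪ (g₀ '' Icc 0 1 ∪ (g₂ '' Icc 0 1 ∪ {p, q})) with hG
  have hGc : IsClosed G := hF.union (s₀.cut.isCompact.isClosed.union
    (s₂.cut.isCompact.isClosed.union (toFinite _).isClosed))
  have hGd : Disjoint G (g₁ '' Icc 0 1) := by
    refine hFd.union_left (d01.union_left (d12.symm.union_left ?_))
    rw [disjoint_left]
    rintro x (rfl | rfl)
    · exact nIcc hp1
    · exact nIcc hq1
  obtain ⟨g, J, hg, hgi, hg0, hg1, hGg, hJ, hJU, hGJ, hgJ, ⟨y, hyJ, hyg⟩, hsep⟩ :=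
    s₁.cut.exists_move_both hU hsc hGc hGd (p := p) (q := q) (by simp [hG, hpU]) (by simp [hG, hqU])
      hTc hT
  have hJ0 : J ⊆ U \ g₀ '' Ioo 0 1 := fun z hz => ⟨hJU hz, fun hh =>
    hGJ.le_bot ⟨Or.inr (Or.inl (image_mono Ioo_subset_Icc_self hh)), hz⟩⟩
  have hJ2 : J ⊆ U \ g₂ '' Ioo 0 1 := fun z hz => ⟨hJU hz, fun hh =>
    hGJ.le_bot ⟨Or.inr (Or.inr (Or.inl (image_mono Ioo_subset_Icc_self hh))), hz⟩⟩
  have hJD₀ : J ⊆ D₀ := s₀.two.1.subset_of_isPreconnected hJ hJ0 ⟨y, hyJ, hγ1 hyg⟩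
  have hJD₂ : Disjoint D₂ J := by
    rw [disjoint_left]
    intro z hz hzJ
    exact (s₁.two.1.subset (h21 (s₂.two.1.subset_of_isPreconnected hJ hJ2 ⟨z, hzJ, hz⟩ hyJ))).2 hyg
  have hog := hg.isOpen_sdiff hU
  have hD₂ : D₂ ⊆ U \ g '' Ioo 0 1 := fun z hz => ⟨(s₂.two.1.subset hz).1, fun hh =>
    hJD₂.le_bot ⟨hz, hgJ hh⟩⟩
  have hE₀ : E₀ ⊆ U \ g '' Ioo 0 1 := fun z hz => ⟨(s₀.two.2.1.subset hz).1, fun hh =>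
    s₀.two.2.2.1 (s₀.two.1.eq_of_mem_of_mem s₀.two.2.1 (hJD₀ (hgJ hh)) hz)⟩
  set D := connectedComponentIn (U \ g '' Ioo 0 1) p with hDdef
  set E := connectedComponentIn (U \ g '' Ioo 0 1) q with hEdef
  have cD : IsCompOf (U \ g '' Ioo 0 1) D := ⟨p, hD₂ hp, rfl⟩
  have cE : IsCompOf (U \ g '' Ioo 0 1) E := ⟨q, hE₀ hq, rfl⟩
  have hpD : p ∈ D := mem_connectedComponentIn (hD₂ hp)
  have hqE : q ∈ E := mem_connectedComponentIn (hE₀ hq)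
  have hqD : q ∉ D := fun hh => by
    have := hsep hh
    rw [← s₁.two.1.eq_of_mem (h21 hp)] at this
    exact hqD₀ (h10 this)
  have hDE : D ≠ E := fun e => hqD (e ▸ hqE)
  have hD₂D : D₂ ⊆ D := cD.subset_of_isPreconnected s₂.two.1.isPreconnected hD₂ ⟨p, hp, hpD⟩
  have hE₀E : E₀ ⊆ E := cE.subset_of_isPreconnected s₀.two.2.1.isPreconnected hE₀ ⟨q, hq, hqE⟩
  have hD0 : D ⊆ U \ g₀ '' Ioo 0 1 := fun z hz => ⟨(cD.subset hz).1, fun hh => by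
    have hz' : z ∈ closure E₀ := by
      rw [s₀.two.2.1.eq_of_mem hq]
      exact s₀.cut.image_subset_closure hU hsc (s₀.two.2.1.subset hq) hh
    obtain ⟨x, hxD, hxE⟩ := mem_closure_iff.1 hz' D (cD.isOpen hog) hz
    exact hDE (cD.eq_of_mem_of_mem cE hxD (hE₀E hxE))⟩
  have hDD₀ : D ⊆ D₀ := s₀.two.1.subset_of_isPreconnected cD.isPreconnected hD0
    ⟨p, hpD, h10 (h21 hp)⟩
  have side : IsSide U T g D E := by
    refine ⟨hg, hg0, hg1, ⟨cD, cE, hDE, fun x hx => ?_⟩, ?_, ?_⟩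
    · have cx : IsCompOf (U \ g '' Ioo 0 1) (connectedComponentIn (U \ g '' Ioo 0 1) x) := ⟨x, hx, rfl⟩
      have hxx := mem_connectedComponentIn hx
      rcases hg.mem_connectedComponentIn_of_three hU hsc hgi (hD₂ hp) (hE₀ hq) hx with h | h | h
      · exact absurd h hqD
      · exact Or.inl (cx.eq_of_mem_of_mem cD hxx h)
      · exact Or.inr (cx.eq_of_mem_of_mem cE hxx h)
    · exact exists_frontier_inter hU hsc s₂.cut hg s₂.two.1 (s₂.front.mono inter_subset_left) hD₂D
        (cD.subset.trans sdiff_subset) (cD.isOpen hog) hTc hT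
    · exact exists_frontier_inter hU hsc s₀.cut hg s₀.two.2.1 (s₀.front'.mono inter_subset_left) hE₀E
        (cE.subset.trans sdiff_subset) (cE.isOpen hog) hTc hT
  refine ⟨D, ⟨g, E, side⟩, hD₂D, hDD₀, ?_, ?_, ?_⟩
  · rw [side.closure_bdIn hU hsc]
    exact hGg.mono_left subset_union_left
  · rw [side.closure_bdIn hU hsc]
    refine (toFinite {g 0, g 1}).subset ?_
    rintro _ ⟨⟨t, ht, rfl⟩, htU⟩
    rcases ht.1.eq_or_lt with rfl | ht0
    · exact Or.inl rfl
    rcases ht.2.eq_or_lt with rfl | ht1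
    · exact Or.inr rfl
    exact absurd (hg.mem t ⟨ht0, ht1⟩) htU
  · rw [hg.bdIn_eq hU hsc cD]
    exact hJD₂.mono_right hgJ

lemma isOpen_of_isCrossSection {U D : Set (ℝ × ℝ)} (hU : IsOpen U) (h : IsCrossSection U D) :
    IsOpen D := by
  obtain ⟨g, E, s⟩ := isCrossSection_iff.1 h
  exact s.two.1.isOpen (s.cut.isOpen_sdiff hU)

lemma closure_bdIn_inter_subset {Y : Type*} [TopologicalSpace Y] {U D : Set Y} (hD : IsOpen D) :
    closure (bdIn U D) ∩ U ⊆ bdIn U D := by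
  rintro x ⟨hx, hxU⟩
  have hcl : IsClosed (closure D \ D) := isClosed_closure.sdiff hD
  exact ⟨closure_minimal inter_subset_left hcl hx, hxU⟩

lemma exists_isSectionOff_step {U T : Set (ℝ × ℝ)} (hU : IsOpen U) (hsc : SimplyConnectedSpace U)
    (hTc : IsClosed T) (hT : IsTotallyDisconnected T) {D : ℕ → Set (ℝ × ℝ)} (hD : IsPEChain U D)
    {n : ℕ} {Q : Set (ℝ × ℝ)} (hQ : IsClosed Q) (hQd : ∀ k ≥ n, Disjoint Q (closure (bdIn U (D k)))) :
    ∃ n' E, n + 2 ≤ n' ∧ IsSectionOff U T E ∧ D (n + 2) ⊆ E ∧ E ⊆ D n ∧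
      Disjoint Q (closure (bdIn U E)) ∧
      ∀ k ≥ n', Disjoint (Q ∪ closure (bdIn U E)) (closure (bdIn U (D k))) := by
  obtain ⟨hsec, hmono, hdisj⟩ := hD
  have hd : ∀ i j, i ≠ j → Disjoint (closure (bdIn U (D i))) (closure (bdIn U (D j))) :=
    fun i j hij => disjoint_iff_inter_eq_empty.2 (hdisj i j hij)
  obtain ⟨E, hE, hDE, hED, hQE, hfin, hDEd⟩ := exists_isSectionOff_between hU hsc hTc hT (hsec n)
    (hsec (n + 1)) (hsec (n + 2)) (hmono _ _ (by omega)) (hmono _ _ (by omega))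
    (hd _ _ (by omega)) (hd _ _ (by omega)) hQ (hQd _ (by omega))
  have hev : ∀ᶠ k in atTop, ∀ x ∈ closure (bdIn U E) \ U, x ∉ closure (bdIn U (D k)) := by
    rw [eventually_all_finite hfin]
    intro x _
    by_cases hx : ∃ k, x ∈ closure (bdIn U (D k))
    · obtain ⟨k, hk⟩ := hx
      filter_upwards [eventually_gt_atTop k] with j hj hxj
      exact (hd k j hj.ne).le_bot ⟨hk, hxj⟩
    · exact Eventually.of_forall fun k hk => hx ⟨k, hk⟩
  obtain ⟨N, hN⟩ := eventually_atTop.1 hev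
  refine ⟨max N (n + 3), E, (by omega), hE, hDE, hED, hQE, fun k hk => ?_⟩
  refine (hQd k (by omega)).union_left (disjoint_left.2 fun x hxE hxk => ?_)
  by_cases hxU : x ∈ U
  · obtain ⟨g, G, s⟩ := isCrossSection_iff.1 (hsec k)
    obtain ⟨g₂, G₂, s₂⟩ := isCrossSection_iff.1 (hsec (n + 2))
    have hx2 : x ∈ D (n + 2) := by
      refine s.image_subset hU hsc s₂ (hmono _ _ (by omega)) ?_ ?_
      · rw [← s.closure_bdIn hU hsc, ← s₂.closure_bdIn hU hsc]
        exact hd _ _ (by omega)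
      · rw [← s.cut.bdIn_eq hU hsc s.two.1]
        exact closure_bdIn_inter_subset (isOpen_of_isCrossSection hU (hsec k)) ⟨hxk, hxU⟩
    exact hDEd.le_bot ⟨hx2, closure_bdIn_inter_subset
      (isOpen_of_isCrossSection hU hE.isCrossSection) ⟨hxE, hxU⟩⟩
  · exact hN k (by omega) x ⟨hxE, hxU⟩ hxk

/-- Every chain is equivalent to one whose cross-cuts end off a given closed totally disconnected
set. -/
theorem exists_equivalent_chain {U T : Set (ℝ × ℝ)} (hU : IsOpen U) (hsc : SimplyConnectedSpace U)
    (hTc : IsClosed T) (hT : IsTotallyDisconnected T) {D : ℕ → Set (ℝ × ℝ)} (hD : IsPEChain U D) :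
    ∃ D', IsPEChain U D' ∧ (∀ i, IsSectionOff U T (D' i)) ∧ ChainDivides D D' ∧
      ChainDivides D' D := by
  let State := {s : ℕ × Set (ℝ × ℝ) //
    IsClosed s.2 ∧ ∀ k ≥ s.1, Disjoint s.2 (closure (bdIn U (D k)))}
  choose n E hn hE hDE hED hQE hinv using fun s : State =>
    exists_isSectionOff_step hU hsc hTc hT hD s.2.1 s.2.2
  let next : State → State := fun s =>
    ⟨(n s, s.1.2 ∪ closure (bdIn U (E s))), s.2.1.union isClosed_closure, hinv s⟩
  let s : ℕ → State := fun k => next^[k] ⟨(0, ∅), isClosed_empty, fun _ _ => empty_disjoint _⟩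
  have hs : ∀ k, s (k + 1) = next (s k) := fun k => Function.iterate_succ_apply' next k _
  have hs1 : ∀ k, (s (k + 1)).1.1 = n (s k) := fun k => by rw [hs]
  have hs2 : ∀ k, (s (k + 1)).1.2 = (s k).1.2 ∪ closure (bdIn U (E (s k))) := fun k => by rw [hs]
  have hge : ∀ k, k ≤ (s k).1.1 := fun k => by
    induction k with
    | zero => exact Nat.zero_le _
    | succ k ih =>
      have := hn (s k)
      rw [hs1]
      omega
  have hQ : ∀ i j, i < j → closure (bdIn U (E (s i))) ⊆ (s j).1.2 := fun i j hij => by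
    induction j, hij using Nat.le_induction with
    | base => rw [hs2]; exact subset_union_right
    | succ j _ ih => rw [hs2]; exact ih.trans subset_union_left
  have hdlt : ∀ i j, i < j →
      Disjoint (closure (bdIn U (E (s i)))) (closure (bdIn U (E (s j)))) :=
    fun i j hij => (hQE (s j)).mono_left (hQ i j hij)
  have hanti : Antitone fun k => E (s k) := antitone_nat_of_succ_le fun k =>
    (hED (s (k + 1))).trans ((hD.2.1 _ _ (by rw [hs1]; exact hn (s k))).trans (hDE (s k)))
  refine ⟨fun k => E (s k), ⟨fun i => (hE _).isCrossSection, fun i j hij => hanti hij,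
    fun i j hij => ?_⟩, fun i => hE _, fun k => ⟨_, hDE (s k)⟩,
    fun k => ⟨k, (hED (s k)).trans (hD.2.1 _ _ (hge k))⟩⟩
  rcases hij.lt_or_gt with h | h
  · exact disjoint_iff_inter_eq_empty.1 (hdlt i j h)
  · exact disjoint_iff_inter_eq_empty.1 (hdlt j i h).symm

section Subtype

variable {S : Set (ℝ × ℝ)}

lemma image_connectedComponentIn_val {A : Set S} {x : S} (hx : x ∈ A) :
    Subtype.val '' connectedComponentIn A x =
      connectedComponentIn (Subtype.val '' A) (x : ℝ × ℝ) := by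
  apply Subset.antisymm
  · exact (isPreconnected_connectedComponentIn.image _ continuous_subtype_val.continuousOn).subset_connectedComponentIn
      (mem_image_of_mem _ (mem_connectedComponentIn hx)) (image_mono (connectedComponentIn_subset _ _))
  · have hsub : connectedComponentIn (Subtype.val '' A) (x : ℝ × ℝ) ⊆ Subtype.val '' A :=
      connectedComponentIn_subset _ _
    have himg : Subtype.val '' (Subtype.val ⁻¹' connectedComponentIn (Subtype.val '' A) (x : ℝ × ℝ) : Set S) =
        connectedComponentIn (Subtype.val '' A) (x : ℝ × ℝ) :=
      image_preimage_eq_of_subset (hsub.trans (image_subset_range _ _))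
    have hpre : IsPreconnected
        (Subtype.val ⁻¹' connectedComponentIn (Subtype.val '' A) (x : ℝ × ℝ) : Set S) := by
      rw [← IsInducing.subtypeVal.isPreconnected_image, himg]
      exact isPreconnected_connectedComponentIn
    rw [← himg]
    refine image_mono (hpre.subset_connectedComponentIn
      (mem_connectedComponentIn (mem_image_of_mem _ hx)) fun y hy => ?_)
    obtain ⟨z, hz, hzy⟩ := hsub hy
    exact Subtype.ext hzy ▸ hz

lemma isCompOf_image_val {A D : Set S} :
    IsCompOf (Subtype.val '' A) (Subtype.val '' D) ↔ IsCompOf A D := by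
  constructor
  · rintro ⟨_, ⟨x, hx, rfl⟩, h⟩
    rw [← image_connectedComponentIn_val hx] at h
    exact ⟨x, hx, Subtype.val_injective.image_injective h⟩
  · rintro ⟨x, hx, rfl⟩
    exact ⟨x, mem_image_of_mem _ hx, image_connectedComponentIn_val hx⟩

lemma hasTwoComps_image_val {A D E : Set S} :
    HasTwoComps (Subtype.val '' A) (Subtype.val '' D) (Subtype.val '' E) ↔ HasTwoComps A D E := by
  have hinj := Subtype.val_injective (p := fun x => x ∈ S) |>.image_injective
  simp only [HasTwoComps, isCompOf_image_val, hinj.ne_iff, forall_mem_image]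
  refine and_congr_right fun _ => and_congr_right fun _ => and_congr_right fun _ =>
    forall₂_congr fun x hx => ?_
  rw [← image_connectedComponentIn_val hx, hinj.eq_iff, hinj.eq_iff]

variable {U : Set (ℝ × ℝ)}

lemma image_val_preimage_val (hUS : U ⊆ S) : Subtype.val '' (Subtype.val ⁻¹' U : Set S) = U :=
  image_preimage_eq_of_subset (by rwa [Subtype.range_coe])

lemma mem_frontier_preimage_val (hS : IsOpen S) {A : Set (ℝ × ℝ)} {x : S} :
    x ∈ frontier (Subtype.val ⁻¹' A : Set S) ↔ (x : ℝ × ℝ) ∈ frontier A := by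
  rw [← hS.isOpenMap_subtype_val.preimage_frontier_eq_frontier_preimage continuous_subtype_val]
  rfl

lemma mem_frontier_image_val (hS : IsOpen S) {A : Set S} {x : S} :
    (x : ℝ × ℝ) ∈ frontier (Subtype.val '' A) ↔ x ∈ frontier A := by
  rw [← mem_frontier_preimage_val hS, preimage_image_eq _ Subtype.val_injective]

lemma image_val_sdiff (hUS : U ⊆ S) {g : ℝ → ℝ × ℝ} {k : ℝ → S}
    (hk : ∀ t ∈ Icc (0 : ℝ) 1, (k t : ℝ × ℝ) = g t) :
    Subtype.val '' ((Subtype.val ⁻¹' U : Set S) \ k '' Ioo 0 1) = U \ g '' Ioo 0 1 := by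
  rw [image_sdiff Subtype.val_injective, image_val_preimage_val hUS, image_image]
  congr 1
  exact image_congr fun t ht => hk t (Ioo_subset_Icc_self ht)

lemma image_frontier_inter (hS : IsOpen S) {g : ℝ → ℝ × ℝ} {k : ℝ → S}
    (hk : ∀ t ∈ Icc (0 : ℝ) 1, (k t : ℝ × ℝ) = g t) {D : Set S} :
    (frontier (Subtype.val '' D) ∩ (frontier U \ g '' Icc 0 1) ∩ Sᶜᶜ).Nonempty ↔
      (frontier D ∩ (frontier (Subtype.val ⁻¹' U : Set S) \ k '' Icc 0 1)).Nonempty := by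
  have hmem : ∀ x : S, (x : ℝ × ℝ) ∈ g '' Icc 0 1 ↔ x ∈ k '' Icc 0 1 := fun x => by
    constructor
    · rintro ⟨t, ht, hx⟩
      exact ⟨t, ht, Subtype.ext ((hk t ht).trans hx)⟩
    · rintro ⟨t, ht, rfl⟩
      exact ⟨t, ht, (hk t ht).symm⟩
  rw [compl_compl]
  constructor
  · rintro ⟨x, ⟨hx1, hx2, hx3⟩, hxS⟩
    exact ⟨⟨x, hxS⟩, (mem_frontier_image_val hS).1 hx1, (mem_frontier_preimage_val hS).2 hx2,
      fun hh => hx3 ((hmem ⟨x, hxS⟩).2 hh)⟩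
  · rintro ⟨x, hx1, hx2, hx3⟩
    exact ⟨x, ⟨(mem_frontier_image_val hS).2 hx1, (mem_frontier_preimage_val hS).1 hx2,
      fun hh => hx3 ((hmem x).1 hh)⟩, x.2⟩

/-- Cross-sections in an open subspace are the plane cross-sections whose cross-cuts end there. -/
theorem isCrossSection_preimage_val (hS : IsOpen S) (hUS : U ⊆ S) {D : Set S} :
    IsCrossSection (Subtype.val ⁻¹' U : Set S) D ↔ IsSectionOff U Sᶜ (Subtype.val '' D) := by
  have aux : ∀ {γ : Set S} {x y : Set S}, HasTwoComps γ x y → IsCompOf γ D →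
      D = x ∨ D = y := by
    rintro γ x y h ⟨z, hz, rfl⟩
    exact h.2.2.2 z hz
  constructor
  · rintro ⟨_, ⟨k, hc, hi, hm, h0, h1, rfl, D₁, D₂, h2, hf1, hf2⟩, hD⟩
    have hk : ∀ t ∈ Icc (0 : ℝ) 1, (k t : ℝ × ℝ) = (fun t => (k t : ℝ × ℝ)) t := fun _ _ => rfl
    have hcut : IsCut U (fun t => (k t : ℝ × ℝ)) :=
      ⟨continuous_subtype_val.comp_continuousOn hc, Subtype.val_injective.comp_injOn hi, hm,
        (mem_frontier_preimage_val hS).1 h0, (mem_frontier_preimage_val hS).1 h1⟩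
    have h2' := hasTwoComps_image_val.2 h2
    rw [image_val_sdiff hUS hk] at h2'
    have f1 := (image_frontier_inter hS hk).2 hf1
    have f2 := (image_frontier_inter hS hk).2 hf2
    rcases aux h2 hD with rfl | rfl
    · exact ⟨_, _, hcut, fun hh => hh (k 0).2, fun hh => hh (k 1).2, h2', f1, f2⟩
    · exact ⟨_, _, hcut, fun hh => hh (k 0).2, fun hh => hh (k 1).2,
        ⟨h2'.2.1, h2'.1, h2'.2.2.1.symm, fun x hx => (h2'.2.2.2 x hx).symm⟩, f2, f1⟩
  · rintro ⟨g, E, hcut, h0, h1, h2, hf1, hf2⟩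
    classical
    rw [notMem_compl_iff] at h0 h1
    have hgS : ∀ t ∈ Icc (0 : ℝ) 1, g t ∈ S := fun t ht => by
      rcases ht.1.eq_or_lt with rfl | ht0
      · exact h0
      rcases ht.2.eq_or_lt with rfl | ht1
      · exact h1
      exact hUS (hcut.mem t ⟨ht0, ht1⟩)
    obtain ⟨k, hk⟩ : ∃ k : ℝ → S, ∀ t ∈ Icc (0 : ℝ) 1, (k t : ℝ × ℝ) = g t :=
      ⟨fun t => if h : g t ∈ S then ⟨g t, h⟩ else ⟨g 0, h0⟩, fun t ht => by simp [hgS t ht]⟩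
    have hES : E ⊆ S := (h2.2.1.subset.trans sdiff_subset).trans hUS
    obtain ⟨E, rfl⟩ : ∃ E₀ : Set S, E = Subtype.val '' E₀ := ⟨_, (image_val_preimage_val hES).symm⟩
    rw [image_frontier_inter hS hk] at hf1 hf2
    rw [← image_val_sdiff hUS hk, hasTwoComps_image_val] at h2
    have m0 : (0 : ℝ) ∈ Icc (0 : ℝ) 1 := ⟨le_rfl, zero_le_one⟩
    have m1 : (1 : ℝ) ∈ Icc (0 : ℝ) 1 := ⟨zero_le_one, le_rfl⟩
    refine ⟨_, ⟨k, ?_, ?_, ?_, ?_, ?_, rfl, D, E, h2, hf1, hf2⟩, h2.1⟩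
    · rw [IsInducing.subtypeVal.continuousOn_iff]
      exact hcut.cont.congr hk
    · intro s hs t ht hst
      apply hcut.inj hs ht
      rw [← hk s (Ioo_subset_Icc_self hs), ← hk t (Ioo_subset_Icc_self ht), hst]
    · intro t ht
      rw [mem_preimage, hk t (Ioo_subset_Icc_self ht)]
      exact hcut.mem t ht
    · rw [mem_frontier_preimage_val hS, hk 0 m0]
      exact hcut.left
    · rw [mem_frontier_preimage_val hS, hk 1 m1]
      exact hcut.right

lemma closure_bdIn_preimage_val (hS : IsOpen S) {D : Set S} :
    closure (bdIn (Subtype.val ⁻¹' U : Set S) D) =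
      Subtype.val ⁻¹' closure (bdIn U (Subtype.val '' D)) := by
  have h : bdIn (Subtype.val ⁻¹' U : Set S) D = Subtype.val ⁻¹' bdIn U (Subtype.val '' D) := by
    rw [bdIn, bdIn, preimage_inter, preimage_sdiff, preimage_image_eq _ Subtype.val_injective,
      hS.isOpenMap_subtype_val.preimage_closure_eq_closure_preimage continuous_subtype_val,
      preimage_image_eq _ Subtype.val_injective]
  rw [h, hS.isOpenMap_subtype_val.preimage_closure_eq_closure_preimage continuous_subtype_val]

lemma closure_bdIn_subset (hU : IsOpen U) (hsc : SimplyConnectedSpace U) (hUS : U ⊆ S)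
    {D : Set (ℝ × ℝ)} (h : IsSectionOff U Sᶜ D) : closure (bdIn U D) ⊆ S := by
  obtain ⟨g, E, s⟩ := h
  rw [s.closure_bdIn hU hsc]
  rintro _ ⟨t, ht, rfl⟩
  rcases ht.1.eq_or_lt with rfl | ht0
  · exact not_not.1 s.left_notMem
  rcases ht.2.eq_or_lt with rfl | ht1
  · exact not_not.1 s.right_notMem
  exact hUS (s.cut.mem t ⟨ht0, ht1⟩)

/-- Chains in an open subspace are the plane chains whose cross-cuts end there. -/
theorem isPEChain_preimage_val (hS : IsOpen S) (hU : IsOpen U) (hsc : SimplyConnectedSpace U)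
    (hUS : U ⊆ S) {C : ℕ → Set S} :
    IsPEChain (Subtype.val ⁻¹' U : Set S) C ↔
      IsPEChain U (fun i => Subtype.val '' C i) ∧ ∀ i, IsSectionOff U Sᶜ (Subtype.val '' C i) := by
  simp only [IsPEChain, isCrossSection_preimage_val hS hUS, closure_bdIn_preimage_val hS,
    image_subset_image_iff Subtype.val_injective]
  constructor
  · rintro ⟨h1, h2, h3⟩
    refine ⟨⟨fun i => (h1 i).isCrossSection, h2, fun i j hij => ?_⟩, h1⟩
    have h4 := h3 i j hij
    rw [← preimage_inter, preimage_eq_empty_iff, Subtype.range_coe] at h4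
    exact eq_empty_of_forall_notMem fun x hx =>
      h4.le_bot ⟨hx, closure_bdIn_subset hU hsc hUS (h1 i) hx.1⟩
  · rintro ⟨⟨-, h2, h3⟩, h1⟩
    refine ⟨h1, h2, fun i j hij => ?_⟩
    rw [← preimage_inter, h3 i j hij, preimage_empty]

end Subtype

section Chains

variable {Y : Type u}

lemma chainDivides_refl (C : ℕ → Set Y) : ChainDivides C C := fun n => ⟨n, Subset.rfl⟩

lemma chainDivides_trans {C C' C'' : ℕ → Set Y} (h : ChainDivides C C') (h' : ChainDivides C' C'') :
    ChainDivides C C'' := fun n => by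
  obtain ⟨m, hm⟩ := h' n
  obtain ⟨l, hl⟩ := h m
  exact ⟨l, hl.trans hm⟩

variable [TopologicalSpace Y] {U : Set Y}

lemma _root_.IsPrimeChain.of_chainDivides {C C' : ℕ → Set Y} (h : IsPrimeChain U C)
    (hC' : IsPEChain U C') (hdiv : ChainDivides C' C) : IsPrimeChain U C' :=
  ⟨hC', fun _ hD hDC' => chainDivides_trans hdiv (h.2 _ hD (chainDivides_trans hDC' hdiv))⟩

lemma primeEnd_mk_eq_iff {C C' : PrimeChain U} :
    (Quot.mk _ C : PrimeEnd U) = Quot.mk _ C' ↔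
      ChainDivides C.1 C'.1 ∧ ChainDivides C'.1 C.1 := by
  refine ⟨fun h => ?_, fun h => Quot.sound h⟩
  have heq : Equivalence fun C C' : PrimeChain U =>
      ChainDivides C.1 C'.1 ∧ ChainDivides C'.1 C.1 :=
    ⟨fun C => ⟨chainDivides_refl _, chainDivides_refl _⟩, fun h => h.symm,
      fun h h' => ⟨chainDivides_trans h.1 h'.1, chainDivides_trans h'.2 h.2⟩⟩
  exact heq.eqvGen_iff.1 (Quot.eqvGen_exact h)

lemma primeEndDivides_mk {C : PrimeChain U} {E : Set Y} :
    PrimeEndDivides (Quot.mk _ C) E ↔ ChainDividesSection C.1 E := by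
  refine ⟨?_, fun h => ⟨C, rfl, h⟩⟩
  rintro ⟨C', h, N, hN⟩
  obtain ⟨m, hm⟩ := (primeEnd_mk_eq_iff.1 h).2 N
  exact ⟨m, fun i hi => (C.2.1.2.1 i m hi).trans (hm.trans (hN N le_rfl))⟩

lemma pePt_mem_peOpen {x : U} {V : Set Y} : pePt U x ∈ peOpen U V ↔ (x : Y) ∈ V := by
  refine ⟨?_, fun h => ⟨x, rfl, h⟩⟩
  rintro ⟨y, h, hy⟩
  rwa [Sum.inl_injective h]

lemma peEnd_notMem_peOpen {p : PrimeEnd U} {V : Set Y} : peEnd U p ∉ peOpen U V := by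
  rintro ⟨y, h, -⟩
  exact Sum.inr_ne_inl h

lemma pePt_mem_peSection {x : U} {E : Set Y} : pePt U x ∈ peSection U E ↔ (x : Y) ∈ E := by
  rw [peSection, mem_union, pePt_mem_peOpen, or_iff_left]
  rintro ⟨p, h, -⟩
  exact Sum.inl_ne_inr h

lemma peEnd_mem_peSection {p : PrimeEnd U} {E : Set Y} :
    peEnd U p ∈ peSection U E ↔ PrimeEndDivides p E := by
  rw [peSection, mem_union, or_iff_right peEnd_notMem_peOpen]
  refine ⟨?_, fun h => ⟨p, rfl, h⟩⟩
  rintro ⟨q, h, hq⟩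
  rwa [Sum.inr_injective h]

lemma isOpen_peOpen {V : Set Y} (hV : IsOpen V) (hVU : V ⊆ U) : IsOpen (peOpen U V) :=
  TopologicalSpace.isOpen_generateFrom_of_mem (Or.inl ⟨V, hV, hVU, rfl⟩)

lemma isOpen_peSection {E : Set Y} (hE : IsCrossSection U E) : IsOpen (peSection U E) :=
  TopologicalSpace.isOpen_generateFrom_of_mem (Or.inr ⟨E, hE, rfl⟩)

end Chains

section Subtype

variable {S U : Set (ℝ × ℝ)}

lemma chainDivides_image_val {C C' : ℕ → Set S} :
    ChainDivides (fun i => Subtype.val '' C i) (fun i => Subtype.val '' C' i) ↔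
      ChainDivides C C' := by
  simp only [ChainDivides, image_subset_image_iff Subtype.val_injective]

lemma chainDividesSection_image_val {C : ℕ → Set S} {E : Set S} :
    ChainDividesSection (fun i => Subtype.val '' C i) (Subtype.val '' E) ↔
      ChainDividesSection C E := by
  simp only [ChainDividesSection, image_subset_image_iff Subtype.val_injective]

/-- Every chain in the plane is equivalent to one that comes from the subspace `S`. -/
lemma exists_chain_preimage_val (hS : IsOpen S) (hT : IsTotallyDisconnected Sᶜ) (hU : IsOpen U)
    (hsc : SimplyConnectedSpace U) (hUS : U ⊆ S) {D : ℕ → Set (ℝ × ℝ)} (hD : IsPEChain U D) :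
    ∃ C : ℕ → Set S, IsPEChain (Subtype.val ⁻¹' U) C ∧
      IsPEChain U (fun i => Subtype.val '' C i) ∧
      ChainDivides D (fun i => Subtype.val '' C i) ∧
      ChainDivides (fun i => Subtype.val '' C i) D := by
  obtain ⟨D', hD', hoff, h1, h2⟩ := exists_equivalent_chain hU hsc hS.isClosed_compl hT hD
  have himg : ∀ i, Subtype.val '' (Subtype.val ⁻¹' D' i : Set S) = D' i := fun i => by
    obtain ⟨g, E, s⟩ := hoff i
    exact image_val_preimage_val ((s.two.1.subset.trans sdiff_subset).trans hUS)
  refine ⟨fun i => Subtype.val ⁻¹' D' i, ?_⟩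
  simp only [isPEChain_preimage_val hS hU hsc hUS, himg]
  exact ⟨⟨hD', hoff⟩, hD', h1, h2⟩

lemma isPrimeChain_image_val (hS : IsOpen S) (hT : IsTotallyDisconnected Sᶜ) (hU : IsOpen U)
    (hsc : SimplyConnectedSpace U) (hUS : U ⊆ S) {C : ℕ → Set S}
    (hC : IsPEChain (Subtype.val ⁻¹' U : Set S) C) :
    IsPrimeChain U (fun i => Subtype.val '' C i) ↔ IsPrimeChain (Subtype.val ⁻¹' U : Set S) C := by
  have hC' := ((isPEChain_preimage_val hS hU hsc hUS).1 hC).1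
  constructor
  · refine fun h => ⟨hC, fun D hD hDC => ?_⟩
    rw [← chainDivides_image_val] at hDC ⊢
    exact h.2 _ ((isPEChain_preimage_val hS hU hsc hUS).1 hD).1 hDC
  · refine fun h => ⟨hC', fun D hD hDC => ?_⟩
    obtain ⟨D', hD', -, h1, h2⟩ := exists_chain_preimage_val hS hT hU hsc hUS hD
    have h3 := chainDivides_image_val.1 (chainDivides_trans h2 hDC)
    exact chainDivides_trans (chainDivides_image_val.2 (h.2 _ hD' h3)) h2

/-- The map induced on prime chains by the inclusion of the subspace `S`. -/
def primeChainMap (hS : IsOpen S) (hT : IsTotallyDisconnected Sᶜ) (hU : IsOpen U)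
    (hsc : SimplyConnectedSpace U) (hUS : U ⊆ S) (C : PrimeChain (Subtype.val ⁻¹' U : Set S)) :
    PrimeChain U :=
  ⟨fun i => Subtype.val '' C.1 i, (isPrimeChain_image_val hS hT hU hsc hUS C.2.1).2 C.2⟩

/-- The map induced on prime ends by the inclusion of the subspace `S`. -/
def primeEndMap (hS : IsOpen S) (hT : IsTotallyDisconnected Sᶜ) (hU : IsOpen U)
    (hsc : SimplyConnectedSpace U) (hUS : U ⊆ S) :
    PrimeEnd (Subtype.val ⁻¹' U : Set S) → PrimeEnd U :=
  Quot.map (primeChainMap hS hT hU hsc hUS) fun _ _ h =>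
    ⟨chainDivides_image_val.2 h.1, chainDivides_image_val.2 h.2⟩

lemma primeEndMap_bijective (hS : IsOpen S) (hT : IsTotallyDisconnected Sᶜ) (hU : IsOpen U)
    (hsc : SimplyConnectedSpace U) (hUS : U ⊆ S) :
    Function.Bijective (primeEndMap hS hT hU hsc hUS) := by
  constructor
  · rintro ⟨C⟩ ⟨C'⟩ h
    have h' := primeEnd_mk_eq_iff.1 h
    exact primeEnd_mk_eq_iff.2 ⟨chainDivides_image_val.1 h'.1, chainDivides_image_val.1 h'.2⟩
  · rintro ⟨D⟩
    obtain ⟨C, hC, hC', h1, h2⟩ := exists_chain_preimage_val hS hT hU hsc hUS D.2.1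
    exact ⟨Quot.mk _ ⟨C, (isPrimeChain_image_val hS hT hU hsc hUS hC).1 (D.2.of_chainDivides hC' h2)⟩,
      primeEnd_mk_eq_iff.2 ⟨h2, h1⟩⟩

lemma primeEndDivides_primeEndMap (hS : IsOpen S) (hT : IsTotallyDisconnected Sᶜ) (hU : IsOpen U)
    (hsc : SimplyConnectedSpace U) (hUS : U ⊆ S) {p : PrimeEnd (Subtype.val ⁻¹' U : Set S)}
    {E : Set S} : PrimeEndDivides (primeEndMap hS hT hU hsc hUS p) (Subtype.val '' E) ↔
      PrimeEndDivides p E := by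
  obtain ⟨C⟩ := p
  exact primeEndDivides_mk.trans (chainDividesSection_image_val.trans primeEndDivides_mk.symm)

/-- The bijection between the prime ends compactifications induced by the inclusion of `S`. -/
def primeEndCompEquiv (hS : IsOpen S) (hT : IsTotallyDisconnected Sᶜ) (hU : IsOpen U)
    (hsc : SimplyConnectedSpace U) (hUS : U ⊆ S) :
    PrimeEndComp (Subtype.val ⁻¹' U : Set S) ≃ PrimeEndComp U :=
  Equiv.sumCongr
    { toFun := fun x => ⟨x.1, x.2⟩
      invFun := fun x => ⟨⟨x, hUS x.2⟩, x.2⟩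
      left_inv := fun _ => rfl
      right_inv := fun _ => rfl }
    (Equiv.ofBijective _ (primeEndMap_bijective hS hT hU hsc hUS))

lemma primeEndCompEquiv_pePt_mem_peOpen (hS : IsOpen S) (hT : IsTotallyDisconnected Sᶜ)
    (hU : IsOpen U) (hsc : SimplyConnectedSpace U) (hUS : U ⊆ S)
    (x : (Subtype.val ⁻¹' U : Set S)) (V : Set (ℝ × ℝ)) :
    primeEndCompEquiv hS hT hU hsc hUS (pePt _ x) ∈ peOpen U V ↔ (x : ℝ × ℝ) ∈ V :=
  pePt_mem_peOpen (U := U) (x := ⟨x, x.2⟩)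

lemma primeEndCompEquiv_pePt_mem_peSection (hS : IsOpen S) (hT : IsTotallyDisconnected Sᶜ)
    (hU : IsOpen U) (hsc : SimplyConnectedSpace U) (hUS : U ⊆ S)
    (x : (Subtype.val ⁻¹' U : Set S)) (E : Set (ℝ × ℝ)) :
    primeEndCompEquiv hS hT hU hsc hUS (pePt _ x) ∈ peSection U E ↔ (x : ℝ × ℝ) ∈ E :=
  pePt_mem_peSection (U := U) (x := ⟨x, x.2⟩)

lemma continuous_primeEndCompEquiv (hS : IsOpen S) (hT : IsTotallyDisconnected Sᶜ) (hU : IsOpen U)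
    (hsc : SimplyConnectedSpace U) (hUS : U ⊆ S) :
    Continuous (primeEndCompEquiv hS hT hU hsc hUS) := by
  set e := primeEndCompEquiv hS hT hU hsc hUS
  have hO := primeEndCompEquiv_pePt_mem_peOpen hS hT hU hsc hUS
  have hsec := primeEndCompEquiv_pePt_mem_peSection hS hT hU hsc hUS
  refine continuous_generateFrom_iff.2 ?_
  rintro _ (⟨V, hV, hVU, rfl⟩ | ⟨E, hE, rfl⟩)
  · have : e ⁻¹' peOpen U V = peOpen _ (Subtype.val ⁻¹' V) := by
      ext (x | p)
      · exact (hO x V).trans (pePt_mem_peOpen (x := x) (V := Subtype.val ⁻¹' V)).symm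
      · exact iff_of_false peEnd_notMem_peOpen peEnd_notMem_peOpen
    rw [this]
    exact isOpen_peOpen (hV.preimage continuous_subtype_val) (preimage_mono hVU)
  · have hEo := isOpen_of_isCrossSection hU hE
    have hEU : E ⊆ U := by
      obtain ⟨γ, -, h⟩ := hE
      exact h.subset.trans sdiff_subset
    rw [isOpen_iff_mem_nhds]
    rintro (x | p) h
    · refine mem_of_superset ((isOpen_peOpen (hEo.preimage continuous_subtype_val)
        (preimage_mono hEU)).mem_nhds (pePt_mem_peOpen.2 ((hsec x E).1 h))) ?_
      rintro _ ⟨y, rfl, hy⟩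
      exact (hsec y E).2 hy
    · obtain ⟨C⟩ := p
      obtain ⟨N, hN⟩ := primeEndDivides_mk.1 (peEnd_mem_peSection.1 h)
      have hCN : Subtype.val '' C.1 N ⊆ E := hN N le_rfl
      refine mem_of_superset ((isOpen_peSection (C.2.1.1 N)).mem_nhds (peEnd_mem_peSection.2
        (primeEndDivides_mk.2 ⟨N, fun i hi => C.2.1.2.1 i N hi⟩))) ?_
      rintro (x | ⟨⟨C'⟩⟩) hx
      · exact (hsec x E).2 (hCN (mem_image_of_mem _ (pePt_mem_peSection.1 hx)))
      · obtain ⟨M, hM⟩ := primeEndDivides_mk.1 (peEnd_mem_peSection.1 hx)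
        exact peEnd_mem_peSection.2 (primeEndDivides_mk.2
          ⟨M, fun i hi => (image_mono (hM i hi)).trans hCN⟩)

lemma continuous_primeEndCompEquiv_symm (hS : IsOpen S) (hT : IsTotallyDisconnected Sᶜ)
    (hU : IsOpen U) (hsc : SimplyConnectedSpace U) (hUS : U ⊆ S) :
    Continuous (primeEndCompEquiv hS hT hU hsc hUS).symm := by
  set e := primeEndCompEquiv hS hT hU hsc hUS
  have hO := primeEndCompEquiv_pePt_mem_peOpen hS hT hU hsc hUS
  have hsec := primeEndCompEquiv_pePt_mem_peSection hS hT hU hsc hUS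
  refine continuous_generateFrom_iff.2 ?_
  rintro _ (⟨V, hV, hVU, rfl⟩ | ⟨E, hE, rfl⟩)
  · have : peOpen _ V = e ⁻¹' peOpen U (Subtype.val '' V) := by
      ext (x | p)
      · exact pePt_mem_peOpen.trans
          ((Subtype.val_injective.mem_set_image (s := V)).symm.trans (hO x _).symm)
      · exact iff_of_false peEnd_notMem_peOpen peEnd_notMem_peOpen
    rw [this, ← preimage_comp, Equiv.self_comp_symm, preimage_id]
    exact isOpen_peOpen (hS.isOpenMap_subtype_val _ hV) (image_subset_iff.2 hVU)
  · have : peSection _ E = e ⁻¹' peSection U (Subtype.val '' E) := by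
      ext (x | p)
      · exact pePt_mem_peSection.trans
          ((Subtype.val_injective.mem_set_image (s := E)).symm.trans (hsec x _).symm)
      · exact peEnd_mem_peSection.trans
          ((primeEndDivides_primeEndMap hS hT hU hsc hUS).symm.trans peEnd_mem_peSection.symm)
    rw [this, ← preimage_comp, Equiv.self_comp_symm, preimage_id]
    exact isOpen_peSection ((isCrossSection_preimage_val hS hUS).1 hE).isCrossSection

/-- The homeomorphism between the prime ends compactifications induced by the inclusion of `S`. -/
def primeEndCompHomeomorph (hS : IsOpen S) (hT : IsTotallyDisconnected Sᶜ) (hU : IsOpen U)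
    (hsc : SimplyConnectedSpace U) (hUS : U ⊆ S) :
    PrimeEndComp (Subtype.val ⁻¹' U : Set S) ≃ₜ PrimeEndComp U where
  toEquiv := primeEndCompEquiv hS hT hU hsc hUS
  continuous_toFun := continuous_primeEndCompEquiv hS hT hU hsc hUS
  continuous_invFun := continuous_primeEndCompEquiv_symm hS hT hU hsc hUS

end Subtype

end PlanePrimeEnds

/-- Prime ends under removal of a totally disconnected set: the inclusion
extends to a homeomorphism `c_E(U,ℝ²) ≃ₜ c_E(U,S₀)`. -/
theorem prime_ends_homeomorphism_totally_disconnected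
    (U : Set (ℝ × ℝ)) (hUopen : IsOpen U) (hUsc : SimplyConnectedSpace ↥U)
    (hUcompl : Set.Nontrivial Uᶜ)
    (S₀ : Set (ℝ × ℝ)) (hS₀open : IsOpen S₀) (hS₀conn : IsConnected S₀)
    (hUS₀ : U ⊆ S₀) (hUne : U ≠ S₀) (hTD : IsTotallyDisconnected S₀ᶜ) :
    ∃ i : PrimeEndComp U ≃ₜ PrimeEndComp (Subtype.val ⁻¹' U : Set ↥S₀),
      ∀ (x : ℝ × ℝ) (hx : x ∈ U) (hx' : x ∈ S₀),
        i (pePt U ⟨x, hx⟩) = pePt (Subtype.val ⁻¹' U : Set ↥S₀) ⟨⟨x, hx'⟩, hx⟩ := by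
  exact ⟨(PlanePrimeEnds.primeEndCompHomeomorph hS₀open hTD hUopen hUsc hUS₀).symm, fun x hx hx' =>
    (PlanePrimeEnds.primeEndCompHomeomorph hS₀open hTD hUopen hUsc hUS₀).symm_apply_eq.2 rfl⟩

end
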